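/- Let 0 < α < 1 and 1 < p < ∞. There exists a constant c > 0 (depending only on α and p) such that for every f in the Hölder class Λ_α(ℝ²), every l ∈ ℤ_{≥0}, and all bounded normal operators N₁, N₂ on a complex Hilbert space H with N₁ − N₂ bounded, one has Σ_{j=0}^{l} ( s_j( |f(N₁) − f(N₂)|^{1/α} ) )^p ≤ c · ‖f‖_{Λ_α}^{p/α} · Σ_{j=0}^{l} ( s_j(N₁ − N₂) )^p. -/

import Mathlib

/-- The `j`-th singular value (approximation number) of a bounded operator `T`:
the distance from `T` to the operators of rank at most `j`. -/
noncomputable def sNum {H : Type*} [NormedAddCommGroup H] [InnerProductSpace ℂ H]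
    (T : H →L[ℂ] H) (j : ℕ) : ℝ :=
  sInf {c : ℝ | ∃ R : H →L[ℂ] H, LinearMap.rank (R : H →ₗ[ℂ] H) ≤ j ∧ c = ‖T - R‖}

/-- `|T| = (T*T)^{1/2}`, defined by the continuous functional calculus. -/
noncomputable def opAbs {H : Type*} [NormedAddCommGroup H] [InnerProductSpace ℂ H]
    [CompleteSpace H] (T : H →L[ℂ] H) : H →L[ℂ] H :=
  cfc (fun t : ℝ => Real.sqrt t) (star T * T)

/-- `|T|^r`, defined by the continuous functional calculus applied to `|T|`. -/
noncomputable def opAbsRpow {H : Type*} [NormedAddCommGroup H] [InnerProductSpace ℂ H]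
    [CompleteSpace H] (T : H →L[ℂ] H) (r : ℝ) : H →L[ℂ] H :=
  cfc (fun t : ℝ => t ^ r) (opAbs T)

section FunctionalCalculus

open MeasureTheory

theorem continuous_cfc_of_continuous_uncurry {A X : Type*} [CStarAlgebra A] [TopologicalSpace X]
    (a : A) (f : X → ℂ → ℂ) (hf : Continuous (Function.uncurry f)) :
    Continuous fun x => cfc (f x) a := by
  refine continuous_iff_continuousAt.2 fun x => continuousAt_cfc_fun ?_
    (.of_forall fun y => (by fun_prop : Continuous (f y)).continuousOn)
  exact ContinuousMap.tendsto_iff_forall_isCompact_tendstoUniformlyOn.1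
    ((ContinuousMap.curry ⟨Function.uncurry f, hf⟩).continuous.tendsto x) _ (spectrum.isCompact a)

/-- The character `z ↦ exp (i ⟪ξ, z⟫)` of the plane. -/
noncomputable def planeWave (ξ z : ℂ) : ℂ := Complex.exp (Complex.I * (inner ℝ ξ z : ℝ))

theorem continuous_uncurry_planeWave : Continuous (Function.uncurry planeWave) := by
  unfold planeWave Function.uncurry
  fun_prop

theorem norm_planeWave (ξ z : ℂ) : ‖planeWave ξ z‖ = 1 := by
  rw [planeWave, mul_comm, Complex.norm_exp_ofReal_mul_I]

theorem norm_cfc_planeWave_le {A : Type*} [CStarAlgebra A] (a : A) (ξ : ℂ) :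
    ‖cfc (planeWave ξ) a‖ ≤ 1 :=
  norm_cfc_le zero_le_one fun z _ => (norm_planeWave ξ z).le

theorem cfc_planeWave_smul {A : Type*} [CStarAlgebra A] (a : A) [IsStarNormal a] (ξ : ℂ) (u : ℝ) :
    cfc (planeWave (u • ξ)) a = NormedSpace.exp
      (u • ((Complex.I / 2) • ((starRingEnd ℂ ξ) • a + ξ • star a))) := by
  have h : u • ((Complex.I / 2) • ((starRingEnd ℂ ξ) • a + ξ • star a)) =
      cfc (fun z : ℂ => ((u : ℂ) * (Complex.I / 2)) *
        (starRingEnd ℂ ξ * z + ξ * star z)) a := by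
    rw [cfc_const_mul _ _ a, cfc_add a _ _, cfc_const_mul _ _ a, cfc_const_mul ξ _ a, cfc_star_id a,
      cfc_id' ℂ a, smul_smul ((u : ℂ)) _ _ |>.symm]
    rfl
  rw [h, ← CFC.complex_exp_eq_normedSpace_exp (cfc_predicate _ a),
    ← cfc_comp' Complex.exp _ a]
  refine cfc_congr fun z _ => ?_
  simp only [planeWave]
  congr 1
  have : (inner ℝ (u • ξ) z : ℝ) = u * (ξ.re * z.re + ξ.im * z.im) := by
    simp [Complex.inner]; ring
  rw [this]
  apply Complex.ext <;> simp <;> first | done | ring_nf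
  exact Or.inr trivial

theorem gaussian_eq_integral_planeWave (z : ℂ) :
    ((Real.exp (-‖z‖ ^ 2 / 2) : ℝ) : ℂ) =
      ∫ ξ : ℂ, (((2 * Real.pi)⁻¹ * Real.exp (-‖ξ‖ ^ 2 / 2) : ℝ) : ℂ) * planeWave ξ z := by
  have := GaussianFourier.integral_cexp_neg_mul_sq_norm_add (V := ℂ) (b := 1 / 2) (by norm_num)
    Complex.I z
  have h2 : ∀ ξ : ℂ, (((2 * Real.pi)⁻¹ * Real.exp (-‖ξ‖ ^ 2 / 2) : ℝ) : ℂ) * planeWave ξ z =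
      (2 * Real.pi : ℂ)⁻¹ *
        Complex.exp (-(1 / 2) * ‖ξ‖ ^ 2 + Complex.I * (inner ℝ z ξ : ℝ)) := by
    intro ξ
    rw [Complex.exp_add, planeWave, real_inner_comm ξ z]
    push_cast
    ring_nf
  simp_rw [h2]
  rw [integral_const_mul, this, Complex.finrank_real_complex]
  have hpi : (Real.pi : ℂ) ≠ 0 := by exact_mod_cast Real.pi_ne_zero
  norm_num
  field_simp

/-- Along the segment joining the two exponentials, the differences of plane waves are controlled by
the difference of the operators. -/
theorem norm_apply_cfc_planeWave_sub_le {A : Type*} [CStarAlgebra A] {a b : A} [IsStarNormal a]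
    [IsStarNormal b] (Λ : A →L[ℂ] ℂ) {κ : ℝ} (hκ : 0 ≤ κ)
    (h₁ : ∀ X Y : A, ‖Λ (X * (a - b) * Y)‖ ≤ κ * (‖X‖ * ‖Y‖))
    (h₂ : ∀ X Y : A, ‖Λ (X * star (a - b) * Y)‖ ≤ κ * (‖X‖ * ‖Y‖)) (ξ : ℂ) (X Y : A) :
    ‖Λ (X * (cfc (planeWave ξ) a - cfc (planeWave ξ) b) * Y)‖ ≤ κ * ‖ξ‖ * (‖X‖ * ‖Y‖) := by
  set p : A := (Complex.I / 2) • ((starRingEnd ℂ ξ) • a + ξ • star a) with hp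
  set q : A := (Complex.I / 2) • ((starRingEnd ℂ ξ) • b + ξ • star b) with hq
  have hpe (u : ℝ) : ‖NormedSpace.exp (u • p)‖ ≤ 1 := by
    rw [← cfc_planeWave_smul]; exact norm_cfc_planeWave_le _ _
  have hqe (u : ℝ) : ‖NormedSpace.exp (u • q)‖ ≤ 1 := by
    rw [← cfc_planeWave_smul]; exact norm_cfc_planeWave_le _ _
  have hmid (X Y : A) : ‖Λ (X * (p - q) * Y)‖ ≤ κ * ‖ξ‖ * (‖X‖ * ‖Y‖) := by
    have : X * (p - q) * Y = (Complex.I / 2 * starRingEnd ℂ ξ) • (X * (a - b) * Y) +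
        (Complex.I / 2 * ξ) • (X * star (a - b) * Y) := by
      simp only [hp, hq, star_sub, mul_smul, ← smul_sub, ← smul_add, smul_mul_assoc, mul_smul_comm,
        mul_sub, sub_mul, mul_add, add_mul]
      congr 1
      simp only [smul_sub]
      abel
    rw [this, map_add, map_smul, map_smul]
    refine (norm_add_le _ _).trans ?_
    simp only [norm_smul, norm_mul, norm_div, Complex.norm_I, RCLike.norm_conj, Complex.norm_ofNat]
    nlinarith [h₁ X Y, h₂ X Y, mul_le_mul_of_nonneg_left (h₁ X Y) (norm_nonneg ξ),
      mul_le_mul_of_nonneg_left (h₂ X Y) (norm_nonneg ξ)]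
  let ψ : ℝ → A := fun u => X * (NormedSpace.exp (u • p) * NormedSpace.exp ((1 - u) • q)) * Y
  have hψ (u : ℝ) : HasDerivAt ψ
      ((X * NormedSpace.exp (u • p)) * (p - q) * (NormedSpace.exp ((1 - u) • q) * Y)) u := by
    have e1 := hasDerivAt_exp_smul_const (𝕂 := ℝ) p u
    have e2 := (hasDerivAt_exp_smul_const' (𝕂 := ℝ) q (1 - u)).scomp u
      ((hasDerivAt_id u).const_sub 1)
    have := ((e1.mul e2).const_mul X).mul_const Y
    convert! this using 1
    simp only [Function.comp, neg_smul, one_smul]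
    noncomm_ring
  have hd (u : ℝ) := (Λ.restrictScalars ℝ).hasFDerivAt.comp_hasDerivAt u (hψ u)
  have := norm_image_sub_le_of_norm_deriv_le_segment_01' (C := κ * ‖ξ‖ * (‖X‖ * ‖Y‖))
    (fun u _ => (hd u).hasDerivWithinAt) (fun u _ => by
      refine (hmid _ _).trans ?_
      have h3 : ‖X * NormedSpace.exp (u • p)‖ ≤ ‖X‖ :=
        (norm_mul_le _ _).trans (mul_le_of_le_one_right (norm_nonneg _) (hpe u))
      have h4 : ‖NormedSpace.exp ((1 - u) • q) * Y‖ ≤ ‖Y‖ :=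
        (norm_mul_le _ _).trans (mul_le_of_le_one_left (norm_nonneg _) (hqe _))
      gcongr)
  have ha : cfc (planeWave ξ) a = NormedSpace.exp p := by
    rw [← one_smul ℝ ξ, cfc_planeWave_smul a ξ 1, one_smul]
  have hb : cfc (planeWave ξ) b = NormedSpace.exp q := by
    rw [← one_smul ℝ ξ, cfc_planeWave_smul b ξ 1, one_smul]
  rw [ha, hb, mul_sub, sub_mul, map_sub]
  simpa [ψ] using this

theorem integrable_exp_neg_norm_sq_div_two :
    Integrable fun ξ : ℂ => Real.exp (-‖ξ‖ ^ 2 / 2) := by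
  have := (GaussianFourier.integrable_cexp_neg_mul_sq_norm_add (V := ℂ) (b := 1 / 2)
    (by norm_num) 0 0).norm
  refine this.congr (.of_forall fun ξ => ?_)
  simp only [Complex.norm_exp]
  congr 1
  simp [← Complex.ofReal_pow]
  ring

theorem integrable_exp_neg_norm_sq_div_two_mul_norm :
    Integrable fun ξ : ℂ => Real.exp (-‖ξ‖ ^ 2 / 2) * ‖ξ‖ := by
  have := (GaussianFourier.integrable_cexp_neg_mul_sq_norm_add (V := ℂ) (b := 1 / 4)
    (by norm_num) 0 0).norm.const_mul 2
  refine this.mono' (by fun_prop) (.of_forall fun ξ => ?_)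
  have h1 : ‖ξ‖ ≤ 2 * Real.exp (‖ξ‖ ^ 2 / 4) := by
    nlinarith [Real.add_one_le_exp (‖ξ‖ ^ 2 / 4), sq_nonneg (‖ξ‖ - 1)]
  rw [Real.norm_of_nonneg (by positivity), Complex.norm_exp]
  have h2 : (-(1 / 4) * (‖ξ‖ : ℂ) ^ 2 + 0 * ((inner ℝ (0:ℂ) ξ : ℝ) : ℂ)).re = -‖ξ‖ ^ 2 / 4 := by
    simp [← Complex.ofReal_pow]; ring
  rw [h2]
  calc _ ≤ Real.exp (-‖ξ‖ ^ 2 / 2) * (2 * Real.exp (‖ξ‖ ^ 2 / 4)) := by gcongr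
    _ = 2 * (Real.exp (-‖ξ‖ ^ 2 / 2) * Real.exp (‖ξ‖ ^ 2 / 4)) := by ring
    _ = _ := by rw [← Real.exp_add]; ring_nf

/-- The weight whose Fourier transform is `z ↦ exp (-‖z‖² / 2)`. -/
noncomputable def gaussianWeight (ξ : ℂ) : ℝ := (2 * Real.pi)⁻¹ * Real.exp (-‖ξ‖ ^ 2 / 2)

/-- The Gaussian bump centred at `w`. -/
noncomputable def gaussianBump (w z : ℂ) : ℂ := (Real.exp (-‖z - w‖ ^ 2 / 2) : ℝ)

theorem gaussianWeight_nonneg (ξ : ℂ) : 0 ≤ gaussianWeight ξ := by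
  unfold gaussianWeight; positivity

@[fun_prop]
theorem continuous_gaussianWeight : Continuous gaussianWeight := by
  unfold gaussianWeight; fun_prop

theorem integrable_gaussianWeight : Integrable gaussianWeight :=
  integrable_exp_neg_norm_sq_div_two.const_mul _

theorem integrable_gaussianWeight_mul_norm : Integrable fun ξ => gaussianWeight ξ * ‖ξ‖ := by
  simpa only [gaussianWeight, mul_assoc] using
    integrable_exp_neg_norm_sq_div_two_mul_norm.const_mul (2 * Real.pi)⁻¹

theorem continuous_uncurry_gaussianBump : Continuous (Function.uncurry gaussianBump) := by
  unfold gaussianBump Function.uncurry; fun_prop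

theorem continuous_cfc_planeWave {A : Type*} [CStarAlgebra A] (a : A) :
    Continuous fun ξ => cfc (planeWave ξ) a :=
  continuous_cfc_of_continuous_uncurry a _ continuous_uncurry_planeWave

theorem continuous_cfc_gaussianBump {A : Type*} [CStarAlgebra A] (a : A) :
    Continuous fun w => cfc (gaussianBump w) a :=
  continuous_cfc_of_continuous_uncurry a _ continuous_uncurry_gaussianBump

@[fun_prop]
theorem continuous_planeWave_comp {X : Type*} [TopologicalSpace X] {f g : X → ℂ}
    (hf : Continuous f) (hg : Continuous g) : Continuous fun x => planeWave (f x) (g x) :=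
  continuous_uncurry_planeWave.comp (hf.prodMk hg)

@[fun_prop]
theorem continuous_gaussianBump_comp {X : Type*} [TopologicalSpace X] {f g : X → ℂ}
    (hf : Continuous f) (hg : Continuous g) : Continuous fun x => gaussianBump (f x) (g x) :=
  continuous_uncurry_gaussianBump.comp (hf.prodMk hg)

theorem planeWave_sub (ξ z w : ℂ) : planeWave ξ (z - w) = planeWave ξ (-w) * planeWave ξ z := by
  simp only [planeWave, ← Complex.exp_add]
  congr 1
  rw [inner_sub_right, inner_neg_right]
  push_cast
  ring

theorem integrable_gaussianWeight_smul {A : Type*} [CStarAlgebra A] {D : ℂ → A} {C : ℝ}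
    (hD : Continuous D) (hC : ∀ ξ, ‖D ξ‖ ≤ C) (w : ℂ) :
    Integrable fun ξ => ((gaussianWeight ξ : ℂ) * planeWave ξ w) • D ξ := by
  refine (integrable_gaussianWeight.mul_const C).mono'
    (Continuous.aestronglyMeasurable (by fun_prop)) (.of_forall fun ξ => ?_)
  rw [norm_smul, norm_mul, norm_planeWave, mul_one, Complex.norm_real,
    Real.norm_of_nonneg (gaussianWeight_nonneg _)]
  exact mul_le_mul_of_nonneg_left (hC ξ) (gaussianWeight_nonneg _)

theorem cfc_gaussianBump_eq_integral {A : Type*} [CStarAlgebra A] (a : A) [IsStarNormal a] (w : ℂ) :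
    cfc (gaussianBump w) a =
      ∫ ξ, ((gaussianWeight ξ : ℂ) * planeWave ξ (-w)) • cfc (planeWave ξ) a := by
  have h1 : gaussianBump w = fun z => ∫ ξ, (gaussianWeight ξ : ℂ) * planeWave ξ (z - w) := by
    funext z
    simpa only [gaussianWeight, gaussianBump] using gaussian_eq_integral_planeWave (z - w)
  rw [h1, cfc_integral _ gaussianWeight a _ _ integrable_gaussianWeight.hasFiniteIntegral]
  · refine integral_congr_ae (.of_forall fun ξ => ?_)
    simp only [planeWave_sub, ← mul_assoc]
    rw [cfc_const_mul _ _ a (by fun_prop)]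
  · refine Continuous.continuousOn ?_
    unfold Function.uncurry
    fun_prop
  · refine .of_forall fun ξ z _ => ?_
    rw [norm_mul, norm_planeWave, mul_one, Complex.norm_real,
      Real.norm_of_nonneg (gaussianWeight_nonneg _)]

theorem norm_integral_apply_gaussianBump_sub_le {A : Type*} [CStarAlgebra A] {a b : A}
    [IsStarNormal a] [IsStarNormal b] (L : A →L[ℂ] A →L[ℂ] ℂ) {κ B C : ℝ}
    (hL : ∀ X ξ, ‖L X (cfc (planeWave ξ) a - cfc (planeWave ξ) b)‖ ≤ κ * ‖ξ‖ * ‖X‖) (hκ : 0 ≤ κ)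
    {X : ℂ → A} (hXc : Continuous X) (hXi : Integrable X) {h : ℂ → ℂ} (hc : Continuous h)
    (hB : ∀ w, ‖h w‖ ≤ B)
    (hX : ∀ c : ℂ → ℂ, Continuous c → (∀ w, ‖c w‖ ≤ B) → ‖∫ w, c w • X w‖ ≤ C) :
    ‖∫ w, h w * L (X w) (cfc (gaussianBump w) a - cfc (gaussianBump w) b)‖ ≤
      κ * C * ∫ ξ, gaussianWeight ξ * ‖ξ‖ := by
  have hB0 : 0 ≤ B := (norm_nonneg _).trans (hB 0)
  set D : ℂ → A := fun ξ => cfc (planeWave ξ) a - cfc (planeWave ξ) b with hDdef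
  have hDc : Continuous D := (continuous_cfc_planeWave a).sub (continuous_cfc_planeWave b)
  have hD2 (ξ : ℂ) : ‖D ξ‖ ≤ 2 := (norm_sub_le _ _).trans
    (by linarith [norm_cfc_planeWave_le a ξ, norm_cfc_planeWave_le b ξ])
  have e1 (w : ℂ) : h w * L (X w) (cfc (gaussianBump w) a - cfc (gaussianBump w) b) =
      ∫ ξ, h w * ((gaussianWeight ξ : ℂ) * planeWave ξ (-w) * L (X w) (D ξ)) := by
    rw [cfc_gaussianBump_eq_integral, cfc_gaussianBump_eq_integral, ← integral_sub
      (integrable_gaussianWeight_smul (continuous_cfc_planeWave a) (norm_cfc_planeWave_le a) _)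
      (integrable_gaussianWeight_smul (continuous_cfc_planeWave b) (norm_cfc_planeWave_le b) _),
      integral_const_mul]
    simp_rw [← smul_sub]
    rw [← ContinuousLinearMap.integral_comp_comm _ (integrable_gaussianWeight_smul hDc hD2 _)]
    simp only [map_smul, smul_eq_mul]
  have hLc : Continuous fun p : ℂ × ℂ => L (X p.1) (D p.2) := by fun_prop
  have h_int : Integrable (Function.uncurry fun w ξ : ℂ =>
      h w * ((gaussianWeight ξ : ℂ) * planeWave ξ (-w) * L (X w) (D ξ)))
      (volume.prod volume) := by
    have hdom := (hXi.norm.const_mul (B * ‖L‖ * 2)).mul_prod integrable_gaussianWeight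
    refine hdom.mono' (Continuous.aestronglyMeasurable ?_) (.of_forall fun p => ?_)
    · unfold Function.uncurry; fun_prop
    · simp only [Function.uncurry, norm_mul, norm_planeWave, mul_one, Complex.norm_real,
        Real.norm_of_nonneg (gaussianWeight_nonneg _)]
      have := gaussianWeight_nonneg p.2
      calc _ ≤ B * (gaussianWeight p.2 * (‖L‖ * ‖X p.1‖ * 2)) := by
            gcongr
            · exact hB _
            · exact (L.le_opNorm₂ _ _).trans (by gcongr; exact hD2 _)
        _ = _ := by ring
  simp_rw [e1]
  rw [integral_integral_swap h_int, ← integral_const_mul]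
  refine norm_integral_le_of_norm_le (integrable_gaussianWeight_mul_norm.const_mul _)
    (.of_forall fun ξ => ?_)
  have hi : Integrable fun w => (h w * planeWave ξ (-w)) • X w := by
    refine (hXi.norm.const_mul B).mono' (Continuous.aestronglyMeasurable (by fun_prop))
      (.of_forall fun w => ?_)
    rw [norm_smul, norm_mul, norm_planeWave, mul_one]
    gcongr
    exact hB w
  have e2 : ∫ w, h w * ((gaussianWeight ξ : ℂ) * planeWave ξ (-w) * L (X w) (D ξ)) =
      gaussianWeight ξ * L (∫ w, (h w * planeWave ξ (-w)) • X w) (D ξ) := by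
    rw [← ContinuousLinearMap.flip_apply L, ← ContinuousLinearMap.integral_comp_comm _ hi,
      ← integral_const_mul]
    refine integral_congr_ae (.of_forall fun w => ?_)
    simp only [map_smul, smul_eq_mul, ContinuousLinearMap.flip_apply]
    ring
  rw [e2, norm_mul, Complex.norm_real, Real.norm_of_nonneg (gaussianWeight_nonneg _)]
  have h3 := hX (fun w => h w * planeWave ξ (-w)) (by fun_prop) (fun w => by
    rw [norm_mul, norm_planeWave, mul_one]; exact hB w)
  calc _ ≤ gaussianWeight ξ * (κ * ‖ξ‖ * C) := by
        have := gaussianWeight_nonneg ξ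
        gcongr
        exact (hL _ _).trans (by gcongr)
    _ = _ := by ring

theorem norm_gaussianBump (w z : ℂ) : ‖gaussianBump w z‖ = Real.exp (-‖z - w‖ ^ 2 / 2) := by
  rw [gaussianBump, Complex.norm_real, Real.norm_of_nonneg (Real.exp_pos _).le]

theorem norm_gaussianBump_le_one (w z : ℂ) : ‖gaussianBump w z‖ ≤ 1 := by
  rw [norm_gaussianBump, Real.exp_le_one_iff]
  have := sq_nonneg ‖z - w‖
  linarith

theorem integral_norm_gaussianBump (z : ℂ) :
    ∫ w, ‖gaussianBump w z‖ = ∫ v : ℂ, Real.exp (-‖v‖ ^ 2 / 2) := by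
  simp_rw [norm_gaussianBump]
  exact integral_sub_left_eq_self (fun v : ℂ => Real.exp (-‖v‖ ^ 2 / 2)) volume z

theorem integrable_norm_gaussianBump (z : ℂ) : Integrable fun w => ‖gaussianBump w z‖ := by
  simp_rw [norm_gaussianBump]
  exact integrable_exp_neg_norm_sq_div_two.comp_sub_left z

/-- On a bounded set, the Gaussian bumps are dominated by an integrable function of the centre. -/
theorem exists_integrable_bound_gaussianBump {s : Set ℂ} (hs : Bornology.IsBounded s) :
    ∃ β : ℂ → ℝ, Integrable β ∧ ∀ w, ∀ z ∈ s, ‖gaussianBump w z‖ ≤ β w := by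
  obtain ⟨R, hR⟩ := hs.exists_norm_le
  have h := (integrable_exp_neg_norm_sq_div_two.comp_smul (R := (√2)⁻¹) (by positivity)).const_mul
    (Real.exp (R ^ 2 / 2))
  refine ⟨_, h, fun w z hz => ?_⟩
  rw [norm_gaussianBump, ← Real.exp_add, Real.exp_le_exp, norm_smul, mul_pow, Real.norm_eq_abs,
    sq_abs, inv_pow, Real.sq_sqrt zero_le_two]
  have h1 : ‖w‖ ≤ ‖z - w‖ + ‖z‖ := by
    simpa using norm_sub_le (z) (z - w) |>.trans (by rw [add_comm])
  have h2 := hR z hz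
  nlinarith [norm_nonneg w, norm_nonneg z, norm_nonneg (z - w), sq_nonneg (‖z - w‖ - ‖z‖)]

theorem integrable_cfc_gaussianBump {A : Type*} [CStarAlgebra A] (a : A) [IsStarNormal a] :
    Integrable fun w => cfc (gaussianBump w) a := by
  obtain ⟨β, hβ, h⟩ := exists_integrable_bound_gaussianBump (spectrum.isBounded (𝕜 := ℂ) a)
  exact integrable_cfc _ β a continuous_uncurry_gaussianBump.continuousOn (.of_forall h)
    hβ.hasFiniteIntegral

theorem norm_integral_smul_cfc_gaussianBump_le {A : Type*} [CStarAlgebra A] (a : A)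
    [IsStarNormal a] {B : ℝ} {c : ℂ → ℂ} (hc : Continuous c) (hB : ∀ w, ‖c w‖ ≤ B) :
    ‖∫ w, c w • cfc (gaussianBump w) a‖ ≤ B * ∫ v : ℂ, Real.exp (-‖v‖ ^ 2 / 2) := by
  have hB0 : 0 ≤ B := (norm_nonneg _).trans (hB 0)
  obtain ⟨β, hβ, h⟩ := exists_integrable_bound_gaussianBump (spectrum.isBounded (𝕜 := ℂ) a)
  have e : ∫ w, c w • cfc (gaussianBump w) a = cfc (fun z => ∫ w, c w * gaussianBump w z) a := by
    rw [cfc_integral _ (fun w => B * β w) a _ _ (hβ.const_mul B).hasFiniteIntegral]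
    · refine integral_congr_ae (.of_forall fun w => ?_)
      simp only
      rw [cfc_const_mul _ _ a (by fun_prop)]
    · refine Continuous.continuousOn ?_
      unfold Function.uncurry
      fun_prop
    · refine .of_forall fun w z hz => ?_
      rw [norm_mul]
      exact mul_le_mul (hB w) (h w z hz) (norm_nonneg _) hB0
  rw [e]
  refine norm_cfc_le (by positivity) fun z _ => ?_
  rw [← integral_norm_gaussianBump z, ← integral_const_mul]
  refine norm_integral_le_of_norm_le ((integrable_norm_gaussianBump z).const_mul B)
    (.of_forall fun w => ?_)
  rw [norm_mul]
  exact mul_le_mul_of_nonneg_right (hB w) (norm_nonneg _)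

/-- The Gaussian probability density on the plane. -/
noncomputable def gaussianDensity (v : ℂ) : ℝ := Real.pi⁻¹ * Real.exp (-‖v‖ ^ 2)

/-- The Gaussian regularization of `f` at scale `δ`. -/
noncomputable def mollify (δ : ℝ) (f : ℂ → ℂ) (z : ℂ) : ℂ :=
  ∫ v, (gaussianDensity v : ℂ) * f (z + δ * v)

theorem mollify_one_eq (h : ℂ → ℂ) (z : ℂ) :
    mollify 1 h z =
      ∫ w, (Real.pi⁻¹ : ℂ) * (h w * (gaussianBump w z * gaussianBump w z)) := by
  rw [mollify, ← integral_sub_right_eq_self _ z]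
  refine integral_congr_ae (.of_forall fun w => ?_)
  have : Real.exp (-‖w - z‖ ^ 2) = Real.exp (-‖z - w‖ ^ 2 / 2) * Real.exp (-‖z - w‖ ^ 2 / 2) := by
    rw [← Real.exp_add, norm_sub_rev]; ring_nf
  simp only [gaussianDensity, gaussianBump, this, Complex.ofReal_one, one_mul, add_sub_cancel]
  push_cast
  ring

theorem cfc_mollify_one {A : Type*} [CStarAlgebra A] (a : A) [IsStarNormal a] {B : ℝ} {h : ℂ → ℂ}
    (hc : Continuous h) (hB : ∀ w, ‖h w‖ ≤ B) :
    Integrable (fun w => (Real.pi⁻¹ : ℂ) • h w •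
      (cfc (gaussianBump w) a * cfc (gaussianBump w) a)) ∧
    cfc (mollify 1 h) a = ∫ w, (Real.pi⁻¹ : ℂ) • h w •
      (cfc (gaussianBump w) a * cfc (gaussianBump w) a) := by
  have hB0 : 0 ≤ B := (norm_nonneg _).trans (hB 0)
  obtain ⟨β, hβ, hb⟩ := exists_integrable_bound_gaussianBump (spectrum.isBounded (𝕜 := ℂ) a)
  have e (w : ℂ) : (Real.pi⁻¹ : ℂ) • h w • (cfc (gaussianBump w) a * cfc (gaussianBump w) a) =
      cfc (fun z => (Real.pi⁻¹ : ℂ) * (h w * (gaussianBump w z * gaussianBump w z))) a := by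
    rw [cfc_const_mul _ _ a (by fun_prop), cfc_const_mul _ _ a (by fun_prop),
      cfc_mul _ _ a (by fun_prop) (by fun_prop)]
  simp_rw [e, funext (mollify_one_eq h)]
  have h1 : ContinuousOn (Function.uncurry fun w z =>
      (Real.pi⁻¹ : ℂ) * (h w * (gaussianBump w z * gaussianBump w z)))
      (Set.univ ×ˢ spectrum ℂ a) := by
    refine Continuous.continuousOn ?_
    unfold Function.uncurry
    fun_prop
  have h2 : ∀ᵐ w : ℂ, ∀ z ∈ spectrum ℂ a,
      ‖(Real.pi⁻¹ : ℂ) * (h w * (gaussianBump w z * gaussianBump w z))‖ ≤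
        Real.pi⁻¹ * (B * β w) := by
    refine .of_forall fun w z hz => ?_
    rw [norm_mul, norm_mul, norm_mul, norm_inv, Complex.norm_real,
      Real.norm_of_nonneg Real.pi_pos.le]
    gcongr
    · exact hB w
    · exact (mul_le_of_le_one_left (norm_nonneg _) (norm_gaussianBump_le_one _ _)).trans (hb w z hz)
  have h3 := ((hβ.const_mul B).const_mul Real.pi⁻¹).hasFiniteIntegral
  exact ⟨integrable_cfc _ _ a h1 h2 h3, cfc_integral _ _ a h1 h2 h3⟩

theorem norm_one_le_one {A : Type*} [CStarAlgebra A] : ‖(1 : A)‖ ≤ 1 := by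
  rcases subsingleton_or_nontrivial A with h | h
  · simp [Subsingleton.elim (1 : A) 0]
  · simp

theorem exists_norm_apply_cfc_mollify_one_sub_le : ∃ C₀ : ℝ, 0 ≤ C₀ ∧
    ∀ {A : Type*} [CStarAlgebra A] {a b : A} [IsStarNormal a] [IsStarNormal b] (Λ : A →L[ℂ] ℂ)
      {κ : ℝ}, 0 ≤ κ → (∀ X Y : A, ‖Λ (X * (a - b) * Y)‖ ≤ κ * (‖X‖ * ‖Y‖)) →
      (∀ X Y : A, ‖Λ (X * star (a - b) * Y)‖ ≤ κ * (‖X‖ * ‖Y‖)) →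
      ∀ {B : ℝ} {h : ℂ → ℂ}, Continuous h → (∀ w, ‖h w‖ ≤ B) →
      ‖Λ (cfc (mollify 1 h) a - cfc (mollify 1 h) b)‖ ≤ C₀ * B * κ := by
  set I₁ : ℝ := ∫ v : ℂ, Real.exp (-‖v‖ ^ 2 / 2)
  set I₂ : ℝ := ∫ ξ, gaussianWeight ξ * ‖ξ‖
  have hI₁ : 0 ≤ I₁ := integral_nonneg fun v => (Real.exp_pos _).le
  have hI₂ : 0 ≤ I₂ := integral_nonneg fun ξ =>
    mul_nonneg (gaussianWeight_nonneg ξ) (norm_nonneg _)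
  refine ⟨2 * Real.pi⁻¹ * I₁ * I₂, by positivity, ?_⟩
  intro A _ a b _ _ Λ κ hκ h₁ h₂ B h hc hB
  have hB0 : 0 ≤ B := (norm_nonneg _).trans (hB 0)
  obtain ⟨hia, hea⟩ := cfc_mollify_one a hc hB
  obtain ⟨hib, heb⟩ := cfc_mollify_one b hc hB
  let L₁ : A →L[ℂ] A →L[ℂ] ℂ :=
    (ContinuousLinearMap.compL ℂ A A ℂ Λ).comp (ContinuousLinearMap.mul ℂ A)
  let L₂ : A →L[ℂ] A →L[ℂ] ℂ :=
    (ContinuousLinearMap.compL ℂ A A ℂ Λ).comp (ContinuousLinearMap.mul ℂ A).flip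
  have b₁ := norm_integral_apply_gaussianBump_sub_le (a := a) (b := b) L₁ (fun X ξ => by
      have := norm_apply_cfc_planeWave_sub_le Λ hκ h₁ h₂ ξ X 1
      rw [mul_one] at this
      exact this.trans (mul_le_mul_of_nonneg_left
        (mul_le_of_le_one_right (norm_nonneg _) norm_one_le_one) (by positivity))) hκ
    (continuous_cfc_gaussianBump a) (integrable_cfc_gaussianBump a) hc hB
    (fun c hc' hB' => norm_integral_smul_cfc_gaussianBump_le a hc' hB')
  have b₂ := norm_integral_apply_gaussianBump_sub_le (a := a) (b := b) L₂ (fun X ξ => by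
      have := norm_apply_cfc_planeWave_sub_le Λ hκ h₁ h₂ ξ 1 X
      rw [one_mul] at this
      exact this.trans (mul_le_mul_of_nonneg_left
        (mul_le_of_le_one_left (norm_nonneg _) norm_one_le_one) (by positivity))) hκ
    (continuous_cfc_gaussianBump b) (integrable_cfc_gaussianBump b) hc hB
    (fun c hc' hB' => norm_integral_smul_cfc_gaussianBump_le b hc' hB')
  have h_int (L : A →L[ℂ] A →L[ℂ] ℂ) {X : ℂ → A} (hX : Continuous X) (hi : Integrable X) :
      Integrable fun w => h w * L (X w) (cfc (gaussianBump w) a - cfc (gaussianBump w) b) := by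
    have c1 := continuous_cfc_gaussianBump a
    have c2 := continuous_cfc_gaussianBump b
    refine (hi.norm.const_mul (B * ‖L‖ * 2)).mono'
      (Continuous.aestronglyMeasurable (by fun_prop)) (.of_forall fun w => ?_)
    have n1 : ‖cfc (gaussianBump w) a‖ ≤ 1 :=
      norm_cfc_le zero_le_one fun z _ => norm_gaussianBump_le_one w z
    have n2 : ‖cfc (gaussianBump w) b‖ ≤ 1 :=
      norm_cfc_le zero_le_one fun z _ => norm_gaussianBump_le_one w z
    rw [norm_mul]
    calc _ ≤ B * (‖L‖ * ‖X w‖ * 2) := by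
          gcongr
          · exact hB w
          · refine (L.le_opNorm₂ _ _).trans ?_
            gcongr
            exact (norm_sub_le _ _).trans (by linarith)
      _ = _ := by ring
  have hiab : Integrable fun w =>
      (Real.pi⁻¹ : ℂ) • h w • (cfc (gaussianBump w) a * cfc (gaussianBump w) a) -
        (Real.pi⁻¹ : ℂ) • h w • (cfc (gaussianBump w) b * cfc (gaussianBump w) b) := hia.sub hib
  have hsplit : Λ (cfc (mollify 1 h) a - cfc (mollify 1 h) b) = (Real.pi⁻¹ : ℂ) *
      ((∫ w, h w * L₁ (cfc (gaussianBump w) a)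
          (cfc (gaussianBump w) a - cfc (gaussianBump w) b)) +
        ∫ w, h w * L₂ (cfc (gaussianBump w) b)
          (cfc (gaussianBump w) a - cfc (gaussianBump w) b)) := by
    rw [← integral_add
      (h_int L₁ (continuous_cfc_gaussianBump a) (integrable_cfc_gaussianBump a))
      (h_int L₂ (continuous_cfc_gaussianBump b) (integrable_cfc_gaussianBump b)),
      ← integral_const_mul, hea, heb, ← integral_sub hia hib,
      ← ContinuousLinearMap.integral_comp_comm _ hiab]
    refine integral_congr_ae (.of_forall fun w => ?_)
    simp only [L₁, L₂, ContinuousLinearMap.comp_apply, ContinuousLinearMap.compL_apply,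
      ContinuousLinearMap.mul_apply', ContinuousLinearMap.flip_apply, map_sub, map_smul,
      smul_eq_mul, mul_sub]
    ring
  rw [hsplit, norm_mul, norm_inv, Complex.norm_real, Real.norm_of_nonneg Real.pi_pos.le]
  calc _ ≤ Real.pi⁻¹ * (κ * (B * I₁) * I₂ + κ * (B * I₁) * I₂) := by
        gcongr
        exact (norm_add_le _ _).trans (add_le_add b₁ b₂)
    _ = _ := by ring

theorem gaussianDensity_nonneg (v : ℂ) : 0 ≤ gaussianDensity v := by
  unfold gaussianDensity; positivity

@[fun_prop]
theorem continuous_gaussianDensity : Continuous gaussianDensity := by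
  unfold gaussianDensity; fun_prop

theorem gaussianDensity_le (v : ℂ) :
    gaussianDensity v ≤ Real.pi⁻¹ * Real.exp (-‖v‖ ^ 2 / 2) := by
  unfold gaussianDensity
  gcongr
  nlinarith [sq_nonneg ‖v‖]

theorem integrable_gaussianDensity : Integrable gaussianDensity :=
  (integrable_exp_neg_norm_sq_div_two.const_mul Real.pi⁻¹).mono'
    continuous_gaussianDensity.aestronglyMeasurable (.of_forall fun v => by
      rw [Real.norm_of_nonneg (gaussianDensity_nonneg v)]
      exact gaussianDensity_le v)

theorem integral_gaussianDensity : ∫ v, gaussianDensity v = 1 := by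
  have := GaussianFourier.integral_rexp_neg_mul_sq_norm (V := ℂ) (b := 1) one_pos
  simp only [gaussianDensity, integral_const_mul]
  simp only [neg_mul, one_mul] at this
  rw [this, Complex.finrank_real_complex]
  norm_num

theorem integrable_gaussianDensity_mul_rpow {α : ℝ} (h0 : 0 ≤ α) (h1 : α ≤ 1) :
    Integrable fun v => gaussianDensity v * ‖v‖ ^ α := by
  refine ((integrable_exp_neg_norm_sq_div_two.add
    integrable_exp_neg_norm_sq_div_two_mul_norm).const_mul Real.pi⁻¹).mono'
    (Continuous.aestronglyMeasurable ?_) (.of_forall fun v => ?_)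
  · have : Continuous fun v : ℂ => ‖v‖ ^ α := continuous_norm.rpow_const fun _ => Or.inr h0
    fun_prop
  · rw [Real.norm_of_nonneg (mul_nonneg (gaussianDensity_nonneg v) (by positivity))]
    have h2 : ‖v‖ ^ α ≤ 1 + ‖v‖ := by
      rcases le_total ‖v‖ 1 with h | h
      · exact (Real.rpow_le_one (norm_nonneg _) h h0).trans (by linarith [norm_nonneg v])
      · calc ‖v‖ ^ α ≤ ‖v‖ ^ (1 : ℝ) := Real.rpow_le_rpow_of_exponent_le h h1
          _ = ‖v‖ := Real.rpow_one _
          _ ≤ _ := by linarith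
    calc _ ≤ (Real.pi⁻¹ * Real.exp (-‖v‖ ^ 2 / 2)) * (1 + ‖v‖) := by
          gcongr
          exact gaussianDensity_le v
      _ = _ := by simp only [Pi.add_apply]; ring

theorem norm_gaussianDensity_mul (v x : ℂ) :
    ‖(gaussianDensity v : ℂ) * x‖ = gaussianDensity v * ‖x‖ := by
  rw [norm_mul, Complex.norm_real, Real.norm_of_nonneg (gaussianDensity_nonneg v)]

section Holder

theorem continuous_of_holder {f : ℂ → ℂ} {M α : ℝ} (hα : 0 < α)
    (hf : ∀ z w, ‖f z - f w‖ ≤ M * ‖z - w‖ ^ α) : Continuous f := by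
  refine continuous_iff_continuousAt.2 fun w => tendsto_iff_norm_sub_tendsto_zero.2 ?_
  have h : Filter.Tendsto (fun z => M * ‖z - w‖ ^ α) (nhds w) (nhds 0) := by
    have : Continuous fun z : ℂ => M * ‖z - w‖ ^ α :=
      continuous_const.mul ((by fun_prop : Continuous fun z : ℂ => ‖z - w‖).rpow_const
        fun _ => Or.inr hα.le)
    simpa [hα.ne'] using this.tendsto w
  exact squeeze_zero (fun _ => norm_nonneg _) (fun z => hf z w) h

theorem integrable_gaussianDensity_mul {f : ℂ → ℂ} {B : ℝ} (hc : Continuous f)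
    (hB : ∀ z, ‖f z‖ ≤ B) (δ : ℝ) (z : ℂ) :
    Integrable fun v => (gaussianDensity v : ℂ) * f (z + δ * v) :=
  (integrable_gaussianDensity.mul_const B).mono' (Continuous.aestronglyMeasurable (by fun_prop))
    (.of_forall fun v => by
      rw [norm_gaussianDensity_mul]
      exact mul_le_mul_of_nonneg_left (hB _) (gaussianDensity_nonneg v))

theorem norm_mollify_le {f : ℂ → ℂ} {B : ℝ} (hB : ∀ z, ‖f z‖ ≤ B) (δ : ℝ) (z : ℂ) :
    ‖mollify δ f z‖ ≤ B := by
  rw [mollify, ← mul_one B, ← integral_gaussianDensity, ← integral_const_mul]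
  refine norm_integral_le_of_norm_le (integrable_gaussianDensity.const_mul B)
    (.of_forall fun v => ?_)
  rw [norm_gaussianDensity_mul, mul_comm]
  exact mul_le_mul_of_nonneg_right (hB _) (gaussianDensity_nonneg v)

theorem mollify_sub {f g : ℂ → ℂ} {B C : ℝ} (hf : Continuous f) (hg : Continuous g)
    (hB : ∀ z, ‖f z‖ ≤ B) (hC : ∀ z, ‖g z‖ ≤ C) (δ : ℝ) (z : ℂ) :
    mollify δ (fun w => f w - g w) z = mollify δ f z - mollify δ g z := by
  simp only [mollify, mul_sub]
  exact integral_sub (integrable_gaussianDensity_mul hf hB δ z)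
    (integrable_gaussianDensity_mul hg hC δ z)

theorem continuous_mollify_one {f : ℂ → ℂ} {B : ℝ} (hc : Continuous f) (hB : ∀ z, ‖f z‖ ≤ B) :
    Continuous (mollify 1 f) :=
  continuous_of_dominated (bound := fun v => gaussianDensity v * B)
    (fun z => (integrable_gaussianDensity_mul hc hB 1 z).aestronglyMeasurable)
    (fun z => .of_forall fun v => by
      rw [norm_gaussianDensity_mul]
      exact mul_le_mul_of_nonneg_left (hB _) (gaussianDensity_nonneg v))
    (integrable_gaussianDensity.mul_const B) (.of_forall fun v => by fun_prop)

theorem mollify_comm {f : ℂ → ℂ} {B : ℝ} (hf : Continuous f) (hB : ∀ z, ‖f z‖ ≤ B) (δ δ' : ℝ) :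
    mollify δ (mollify δ' f) = mollify δ' (mollify δ f) := by
  funext z
  simp only [mollify, ← integral_const_mul]
  rw [integral_integral_swap]
  · refine integral_congr_ae (.of_forall fun v => integral_congr_ae (.of_forall fun u => ?_))
    simp only
    rw [add_right_comm z]
    ring
  · refine ((integrable_gaussianDensity.mul_prod integrable_gaussianDensity).mul_const B).mono'
      (Continuous.aestronglyMeasurable ?_) (.of_forall fun p => ?_)
    · unfold Function.uncurry; fun_prop
    · simp only [Function.uncurry, ← mul_assoc]
      rw [mul_assoc, norm_gaussianDensity_mul, norm_gaussianDensity_mul, mul_assoc]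
      have h1 := gaussianDensity_nonneg p.1
      have h2 := gaussianDensity_nonneg p.2
      gcongr
      exact hB _

variable {f : ℂ → ℂ} {M α B : ℝ}

theorem holder_mollify (hα : 0 < α) (hf : ∀ z w, ‖f z - f w‖ ≤ M * ‖z - w‖ ^ α)
    (hB : ∀ z, ‖f z‖ ≤ B) (δ : ℝ) (z w : ℂ) :
    ‖mollify δ f z - mollify δ f w‖ ≤ M * ‖z - w‖ ^ α := by
  have hc := continuous_of_holder hα hf
  rw [mollify, mollify, ← integral_sub (integrable_gaussianDensity_mul hc hB δ z)
    (integrable_gaussianDensity_mul hc hB δ w), ← mul_one (M * _), ← integral_gaussianDensity,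
    ← integral_const_mul]
  refine norm_integral_le_of_norm_le (integrable_gaussianDensity.const_mul _)
    (.of_forall fun v => ?_)
  rw [← mul_sub, norm_gaussianDensity_mul, mul_comm]
  refine mul_le_mul_of_nonneg_right ((hf _ _).trans_eq ?_) (gaussianDensity_nonneg v)
  rw [add_sub_add_right_eq_sub]

/-- The `α`-th absolute moment of the Gaussian density. -/
noncomputable def gaussianMoment (α : ℝ) : ℝ := ∫ v, gaussianDensity v * ‖v‖ ^ α

theorem gaussianMoment_nonneg (α : ℝ) : 0 ≤ gaussianMoment α :=
  integral_nonneg fun v => mul_nonneg (gaussianDensity_nonneg v) (by positivity)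

theorem norm_sub_mollify_le (hα : 0 < α) (hα1 : α ≤ 1)
    (hf : ∀ z w, ‖f z - f w‖ ≤ M * ‖z - w‖ ^ α) (hB : ∀ z, ‖f z‖ ≤ B) {δ : ℝ} (hδ : 0 ≤ δ)
    (z : ℂ) : ‖f z - mollify δ f z‖ ≤ M * δ ^ α * gaussianMoment α := by
  have hc := continuous_of_holder hα hf
  have e : f z = ∫ v, (gaussianDensity v : ℂ) * f z := by
    rw [integral_mul_const, integral_complex_ofReal, integral_gaussianDensity]
    simp
  have hi : Integrable fun v => (gaussianDensity v : ℂ) * f z :=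
    integrable_gaussianDensity.ofReal.mul_const _
  rw [mollify, e, ← integral_sub hi
    (integrable_gaussianDensity_mul hc hB δ z), gaussianMoment, ← integral_const_mul]
  refine norm_integral_le_of_norm_le
    ((integrable_gaussianDensity_mul_rpow hα.le hα1).const_mul _) (.of_forall fun v => ?_)
  rw [← mul_sub, norm_gaussianDensity_mul]
  calc _ ≤ gaussianDensity v * (M * ‖z - (z + δ * v)‖ ^ α) :=
        mul_le_mul_of_nonneg_left (hf _ _) (gaussianDensity_nonneg v)
    _ = _ := by
        rw [sub_add_cancel_left, norm_neg, norm_mul, Complex.norm_real, Real.norm_of_nonneg hδ,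
          Real.mul_rpow hδ (norm_nonneg _)]
        ring

theorem mollify_eq_mollify_one {δ : ℝ} (hδ : δ ≠ 0) (f : ℂ → ℂ) :
    mollify δ f = fun z => mollify 1 (fun w => f (δ * w)) ((δ : ℂ)⁻¹ • z) := by
  have : (δ : ℂ) ≠ 0 := Complex.ofReal_ne_zero.2 hδ
  funext z
  simp only [mollify, smul_eq_mul, mul_add, mul_inv_cancel_left₀ this, Complex.ofReal_one, one_mul]

section Estimate

variable {A : Type*} [CStarAlgebra A] {a b : A} {Λ : A →L[ℂ] ℂ} {C₀ κ : ℝ}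

theorem norm_apply_cfc_mollify_sub_le_sum (hα : 0 < α) (hα1 : α ≤ 1)
    (hS : ∀ (δ B : ℝ) (h : ℂ → ℂ), 0 < δ → Continuous h → (∀ w, ‖h w‖ ≤ B) →
      ‖Λ (cfc (mollify δ h) a - cfc (mollify δ h) b)‖ ≤ C₀ * B * (κ / δ)) (m : ℕ) :
    ∀ (f : ℂ → ℂ) (δ : ℝ), 0 < δ → (∀ z w, ‖f z - f w‖ ≤ M * ‖z - w‖ ^ α) → (∀ z, ‖f z‖ ≤ B) →
      ‖Λ (cfc (mollify δ f) a - cfc (mollify δ f) b)‖ ≤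
        C₀ * M * 2 ^ α * gaussianMoment α * κ * δ ^ (α - 1) *
          ∑ n ∈ Finset.range m, ((2 : ℝ) ^ (α - 1)) ^ n + C₀ * B * (κ / (2 ^ m * δ)) := by
  induction m with
  | zero =>
    intro f δ hδ hf hB
    simpa using hS δ B f hδ (continuous_of_holder hα hf) hB
  | succ m ih =>
    intro f δ hδ hf hB
    have hc := continuous_of_holder hα hf
    have hfm (δ : ℝ) := holder_mollify hα hf hB δ
    have hcm (δ : ℝ) : Continuous (mollify δ f) := continuous_of_holder hα (hfm δ)
    have hBm (δ : ℝ) := norm_mollify_le hB δ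
    have hdc : Continuous fun w => f w - mollify (2 * δ) f w := hc.sub (hcm _)
    have hmm : Continuous (mollify (2 * δ) (mollify δ f)) :=
      continuous_of_holder hα (holder_mollify hα (hfm δ) (hBm δ) _)
    have e : mollify δ f = fun z => mollify δ (fun w => f w - mollify (2 * δ) f w) z +
        mollify (2 * δ) (mollify δ f) z := by
      funext z
      rw [mollify_sub hc (hcm _) hB (hBm _), mollify_comm hc hB δ (2 * δ), sub_add_cancel]
    have hsc : Continuous (mollify δ fun w => f w - mollify (2 * δ) f w) := by
      have : mollify δ (fun w => f w - mollify (2 * δ) f w) =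
          fun z => mollify δ f z - mollify (2 * δ) (mollify δ f) z := by
        funext z
        rw [mollify_sub hc (hcm _) hB (hBm _), mollify_comm hc hB δ (2 * δ)]
      rw [this]
      exact (hcm _).sub hmm
    have ec (x : A) : cfc (mollify δ f) x = cfc (mollify δ fun w => f w - mollify (2 * δ) f w) x +
        cfc (mollify (2 * δ) (mollify δ f)) x := by
      conv_lhs => rw [e]
      exact cfc_add _ _ _ hsc.continuousOn hmm.continuousOn
    rw [ec a, ec b, add_sub_add_comm, map_add]
    have h1 := hS δ _ _ hδ hdc (norm_sub_mollify_le hα hα1 hf hB (by positivity : 0 ≤ 2 * δ))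
    have h2 := ih (mollify δ f) (2 * δ) (by positivity) (hfm δ) (hBm δ)
    refine (norm_add_le _ _).trans ((add_le_add h1 h2).trans_eq ?_)
    rw [geom_sum_succ, Real.mul_rpow zero_le_two hδ.le, Real.mul_rpow zero_le_two hδ.le,
      Real.rpow_sub_one hδ.ne', pow_succ]
    field_simp
    ring

theorem norm_apply_cfc_mollify_sub_le (hα : 0 < α) (hα1 : α < 1) (hM : 0 ≤ M) (hC₀ : 0 ≤ C₀)
    (hκ : 0 ≤ κ)
    (hS : ∀ (δ B : ℝ) (h : ℂ → ℂ), 0 < δ → Continuous h → (∀ w, ‖h w‖ ≤ B) →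
      ‖Λ (cfc (mollify δ h) a - cfc (mollify δ h) b)‖ ≤ C₀ * B * (κ / δ))
    (hf : ∀ z w, ‖f z - f w‖ ≤ M * ‖z - w‖ ^ α) (hB : ∀ z, ‖f z‖ ≤ B) {δ : ℝ} (hδ : 0 < δ) :
    ‖Λ (cfc (mollify δ f) a - cfc (mollify δ f) b)‖ ≤
      C₀ * M * 2 ^ α * gaussianMoment α * κ * δ ^ (α - 1) * (1 - 2 ^ (α - 1))⁻¹ := by
  have hr1 : (2 : ℝ) ^ (α - 1) < 1 :=
    Real.rpow_lt_one_of_one_lt_of_neg one_lt_two (by linarith)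
  have hr0 : 0 ≤ (2 : ℝ) ^ (α - 1) := by positivity
  have hmom := gaussianMoment_nonneg α
  have ht : Filter.Tendsto (fun m : ℕ => C₀ * M * 2 ^ α * gaussianMoment α * κ * δ ^ (α - 1) *
      (1 - 2 ^ (α - 1))⁻¹ + C₀ * B * (κ / δ) * (1 / 2) ^ m) Filter.atTop
      (nhds (C₀ * M * 2 ^ α * gaussianMoment α * κ * δ ^ (α - 1) * (1 - 2 ^ (α - 1))⁻¹)) := by
    simpa using ((tendsto_pow_atTop_nhds_zero_of_lt_one (by norm_num : (0 : ℝ) ≤ 1 / 2)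
      (by norm_num)).const_mul (C₀ * B * (κ / δ))).const_add
      (C₀ * M * 2 ^ α * gaussianMoment α * κ * δ ^ (α - 1) * (1 - 2 ^ (α - 1))⁻¹)
  refine ge_of_tendsto' ht fun m => ?_
  refine (norm_apply_cfc_mollify_sub_le_sum hα hα1.le hS m f δ hδ hf hB).trans ?_
  refine add_le_add (mul_le_mul_of_nonneg_left ?_ (by positivity)) (le_of_eq ?_)
  · rw [← tsum_geometric_of_lt_one hr0 hr1]
    exact (summable_geometric_of_lt_one hr0 hr1).sum_le_tsum _ fun _ _ => by positivity
  · rw [one_div, inv_pow]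
    field_simp

/-- The coordinatewise projection of the plane onto a square of side `2R`. -/
noncomputable def clampSquare (R : ℝ) (z : ℂ) : ℂ :=
  ⟨max (-R) (min R z.re), max (-R) (min R z.im)⟩

theorem abs_max_min_sub_le (R x y : ℝ) :
    |max (-R) (min R x) - max (-R) (min R y)| ≤ |x - y| := by
  calc _ ≤ |min R x - min R y| := by
        simpa using abs_max_sub_max_le_max (-R) (min R x) (-R) (min R y)
    _ ≤ _ := by simpa using abs_min_sub_min_le_max R x R y

theorem norm_clampSquare_sub_le (R : ℝ) (z w : ℂ) :
    ‖clampSquare R z - clampSquare R w‖ ≤ ‖z - w‖ := by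
  have h1 := sq_le_sq.2 (abs_max_min_sub_le R z.re w.re)
  have h2 := sq_le_sq.2 (abs_max_min_sub_le R z.im w.im)
  rw [Complex.norm_def, Complex.norm_def]
  refine Real.sqrt_le_sqrt ?_
  simp only [Complex.normSq_apply, clampSquare, Complex.sub_re, Complex.sub_im]
  nlinarith

theorem clampSquare_of_norm_le {R : ℝ} {z : ℂ} (h : ‖z‖ ≤ R) : clampSquare R z = z := by
  have h1 := abs_le.1 ((Complex.abs_re_le_norm z).trans h)
  have h2 := abs_le.1 ((Complex.abs_im_le_norm z).trans h)
  apply Complex.ext <;> simp [clampSquare, h1, h2]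

theorem norm_clampSquare_le {R : ℝ} (hR : 0 ≤ R) (z : ℂ) : ‖clampSquare R z‖ ≤ 2 * R := by
  refine (Complex.norm_le_abs_re_add_abs_im _).trans ?_
  have (x : ℝ) : |max (-R) (min R x)| ≤ R :=
    abs_le.2 ⟨le_max_left _ _, max_le (by linarith) (min_le_left _ _)⟩
  simp only [clampSquare]
  linarith [this z.re, this z.im]

theorem norm_apply_cfc_sub_le_of_bounded [IsStarNormal a] [IsStarNormal b] (hα : 0 < α)
    (hα1 : α < 1) (hM : 0 ≤ M) (hC₀ : 0 ≤ C₀)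
    (hκ : 0 ≤ κ)
    (hS : ∀ (δ B : ℝ) (h : ℂ → ℂ), 0 < δ → Continuous h → (∀ w, ‖h w‖ ≤ B) →
      ‖Λ (cfc (mollify δ h) a - cfc (mollify δ h) b)‖ ≤ C₀ * B * (κ / δ))
    (hf : ∀ z w, ‖f z - f w‖ ≤ M * ‖z - w‖ ^ α) (hB : ∀ z, ‖f z‖ ≤ B) {δ : ℝ} (hδ : 0 < δ) :
    ‖Λ (cfc f a - cfc f b)‖ ≤ M * gaussianMoment α * (2 * ‖Λ‖ * δ ^ α +
      C₀ * 2 ^ α * (1 - 2 ^ (α - 1))⁻¹ * κ * δ ^ (α - 1)) := by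
  have hmom := gaussianMoment_nonneg α
  have hc := continuous_of_holder hα hf
  have hcm : Continuous (mollify δ f) := continuous_of_holder hα (holder_mollify hα hf hB δ)
  have h1 (x : A) : ‖Λ (cfc f x - cfc (mollify δ f) x)‖ ≤
      ‖Λ‖ * (M * δ ^ α * gaussianMoment α) := by
    refine (Λ.le_opNorm _).trans ?_
    rw [← cfc_sub _ _ _ hc.continuousOn hcm.continuousOn]
    gcongr
    exact norm_cfc_le (by positivity) fun z _ => norm_sub_mollify_le hα hα1.le hf hB hδ.le z
  have h2 := norm_apply_cfc_mollify_sub_le hα hα1 hM hC₀ hκ hS hf hB hδ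
  have e : cfc f a - cfc f b = (cfc f a - cfc (mollify δ f) a) +
      (cfc (mollify δ f) a - cfc (mollify δ f) b) - (cfc f b - cfc (mollify δ f) b) := by abel
  rw [e, map_sub, map_add]
  refine (norm_sub_le _ _).trans ((add_le_add_left (norm_add_le _ _) _).trans ?_)
  linarith [h1 a, h1 b]

end Estimate

/-- The basic Hölder estimate: `C` depends only on `α`. -/
theorem exists_norm_apply_cfc_sub_le (hα : 0 < α) (hα1 : α < 1) : ∃ C : ℝ, 0 ≤ C ∧
    ∀ {A : Type*} [CStarAlgebra A] {a b : A} [IsStarNormal a] [IsStarNormal b] (Λ : A →L[ℂ] ℂ)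
      {κ : ℝ}, 0 ≤ κ → (∀ X Y : A, ‖Λ (X * (a - b) * Y)‖ ≤ κ * (‖X‖ * ‖Y‖)) →
      (∀ X Y : A, ‖Λ (X * star (a - b) * Y)‖ ≤ κ * (‖X‖ * ‖Y‖)) →
      ∀ {f : ℂ → ℂ} {M : ℝ}, 0 ≤ M → (∀ z w, ‖f z - f w‖ ≤ M * ‖z - w‖ ^ α) →
      ∀ {δ : ℝ}, 0 < δ →
      ‖Λ (cfc f a - cfc f b)‖ ≤ C * M * (‖Λ‖ * δ ^ α + κ * δ ^ (α - 1)) := by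
  obtain ⟨C₀, hC₀, hS⟩ := exists_norm_apply_cfc_mollify_one_sub_le
  have hmom := gaussianMoment_nonneg α
  have hr1 : 0 < 1 - (2 : ℝ) ^ (α - 1) :=
    sub_pos.2 (Real.rpow_lt_one_of_one_lt_of_neg one_lt_two (by linarith))
  set c : ℝ := C₀ * 2 ^ α * (1 - 2 ^ (α - 1))⁻¹ with hc
  have hc0 : 0 ≤ c := by positivity
  refine ⟨gaussianMoment α * (2 + c), by positivity, ?_⟩
  intro A _ a b _ _ Λ κ hκ h₁ h₂ f M hM hf δ hδ
  have hS' (δ B : ℝ) (h : ℂ → ℂ) (hδ : 0 < δ) (hh : Continuous h) (hB : ∀ w, ‖h w‖ ≤ B) :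
      ‖Λ (cfc (mollify δ h) a - cfc (mollify δ h) b)‖ ≤ C₀ * B * (κ / δ) := by
    have hh' : Continuous fun w => h (δ * w) := by fun_prop
    have hcm : Continuous (mollify 1 fun w => h (δ * w)) :=
      continuous_mollify_one hh' fun w => hB _
    have e (x : A) [IsStarNormal x] : cfc (mollify δ h) x =
        cfc (mollify 1 fun w => h (δ * w)) ((δ : ℂ)⁻¹ • x) := by
      rw [mollify_eq_mollify_one hδ.ne', cfc_comp_smul _ _ x hcm.continuousOn]
    rw [e a, e b]
    have hn : ‖(δ : ℂ)⁻¹‖ = δ⁻¹ := by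
      rw [norm_inv, Complex.norm_real, Real.norm_of_nonneg hδ.le]
    refine hS Λ (by positivity) (fun X Y => ?_) (fun X Y => ?_) hh' fun w => hB _
    · rw [← smul_sub, mul_smul_comm, smul_mul_assoc, map_smul, norm_smul, hn, div_eq_inv_mul,
        mul_assoc δ⁻¹]
      exact mul_le_mul_of_nonneg_left (h₁ X Y) (by positivity)
    · rw [← smul_sub, star_smul, mul_smul_comm, smul_mul_assoc, map_smul, norm_smul, norm_star, hn,
        div_eq_inv_mul, mul_assoc δ⁻¹]
      exact mul_le_mul_of_nonneg_left (h₂ X Y) (by positivity)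
  set R : ℝ := max ‖a‖ ‖b‖ with hR
  have hR0 : 0 ≤ R := (norm_nonneg a).trans (le_max_left _ _)
  have ecfc (x : A) (hx : ‖x‖ ≤ R) : cfc f x = cfc (fun z => f (clampSquare R z)) x := by
    refine cfc_congr fun z hz => ?_
    rw [clampSquare_of_norm_le]
    exact (spectrum.norm_le_norm_mul_of_mem hz).trans
      ((mul_le_of_le_one_right (norm_nonneg _) norm_one_le_one).trans hx)
  rw [ecfc a (le_max_left _ _), ecfc b (le_max_right _ _)]
  refine (norm_apply_cfc_sub_le_of_bounded hα hα1 hM hC₀ hκ hS'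
    (B := M * (2 * R) ^ α + ‖f 0‖) (fun z w => (hf _ _).trans ?_) (fun z => ?_) hδ).trans ?_
  · gcongr
    exact norm_clampSquare_sub_le R z w
  · calc _ = ‖(f (clampSquare R z) - f 0) + f 0‖ := by rw [sub_add_cancel]
      _ ≤ _ := (norm_add_le _ _).trans (add_le_add_left ((hf _ _).trans ?_) _)
    rw [sub_zero]
    gcongr
    exact norm_clampSquare_le hR0 z
  · have : 0 ≤ ‖Λ‖ * δ ^ α * c + 2 * (κ * δ ^ (α - 1)) := by positivity
    have h3 := mul_nonneg (mul_nonneg hM hmom) this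
    linarith

end Holder

end FunctionalCalculus

section SingularValues

variable {H : Type*} [NormedAddCommGroup H] [InnerProductSpace ℂ H]

theorem sNum_nonneg (T : H →L[ℂ] H) (j : ℕ) : 0 ≤ sNum T j :=
  Real.sInf_nonneg (by rintro _ ⟨R, -, rfl⟩; exact norm_nonneg _)

theorem sNum_le_norm_sub (T : H →L[ℂ] H) {R : H →L[ℂ] H} {j : ℕ}
    (hR : LinearMap.rank (R : H →ₗ[ℂ] H) ≤ j) : sNum T j ≤ ‖T - R‖ :=
  csInf_le ⟨0, by rintro _ ⟨R, -, rfl⟩; exact norm_nonneg _⟩ ⟨R, hR, rfl⟩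

theorem exists_rank_le_norm_sub_lt (T : H →L[ℂ] H) {j : ℕ} {c : ℝ} (hc : sNum T j < c) :
    ∃ R : H →L[ℂ] H, LinearMap.rank (R : H →ₗ[ℂ] H) ≤ j ∧ ‖T - R‖ < c := by
  rw [sNum] at hc
  obtain ⟨_, ⟨R, hR, rfl⟩, h⟩ := exists_lt_of_csInf_lt (by exact ⟨‖T - 0‖, 0, by simp, rfl⟩) hc
  exact ⟨R, hR, h⟩

theorem sNum_antitone (T : H →L[ℂ] H) : Antitone (sNum T) := by
  intro i j hij
  refine le_of_forall_pos_le_add fun ε hε => ?_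
  obtain ⟨R, hR, h⟩ := exists_rank_le_norm_sub_lt T (lt_add_of_pos_right (sNum T i) hε)
  exact (sNum_le_norm_sub T (hR.trans (by exact_mod_cast hij))).trans h.le

theorem exists_ne_zero_apply_eq_zero {E : Type*} [AddCommGroup E] [Module ℂ E]
    [FiniteDimensional ℂ E] {R : H →ₗ[ℂ] H} {j : ℕ} (hR : LinearMap.rank R ≤ j)
    (hj : j < Module.finrank ℂ E) (B : E →ₗ[ℂ] H) : ∃ x ≠ 0, R (B x) = 0 := by
  have : FiniteDimensional ℂ (LinearMap.range R) :=
    Module.rank_lt_aleph0_iff.1 (hR.trans_lt Cardinal.natCast_lt_aleph0)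
  have h1 : Module.finrank ℂ (LinearMap.range R) ≤ j := Module.finrank_le_of_rank_le hR
  obtain ⟨x, hx, hx0⟩ := Submodule.exists_mem_ne_zero_of_ne_bot
    (LinearMap.ker_ne_bot_of_finrank_lt (f := R.rangeRestrict ∘ₗ B) (h1.trans_lt hj))
  exact ⟨x, hx0, congrArg Subtype.val (LinearMap.mem_ker.1 hx)⟩

theorem Orthonormal.exists_euclidean_map {k : ℕ} {F : Type*} [NormedAddCommGroup F]
    [InnerProductSpace ℂ F] {v : Fin k → F} (hv : Orthonormal ℂ v) :
    ∃ J : EuclideanSpace ℂ (Fin k) →L[ℂ] F, ‖J‖ ≤ 1 ∧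
      ∀ i, J (EuclideanSpace.basisFun (Fin k) ℂ i) = v i := by
  set b := EuclideanSpace.basisFun (Fin k) ℂ
  have h (i : Fin k) : b.toBasis.constr ℂ v (b i) = v i := by
    simp
  let J := (b.toBasis.constr ℂ v).isometryOfOrthonormal (v := b.toBasis)
    (by simp) (by simpa [Function.comp_def, h] using hv)
  exact ⟨J.toContinuousLinearMap, J.norm_toContinuousLinearMap_le, h⟩

/-- Orthonormal families along which `T` is bounded below by a number less than `sNum T (2 k)`. -/
theorem exists_orthonormal_lt_inner (T : H →L[ℂ] H) {k : ℕ} {t : ℝ} (ht : 0 ≤ t)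
    (htT : t < sNum T (2 * k)) : ∀ m ≤ k + 1, ∃ g e : Fin m → H, Orthonormal ℂ g ∧ Orthonormal ℂ e ∧
      ∀ i, ∃ r : ℝ, t ≤ r ∧ inner ℂ (g i) (T (e i)) = r := by
  intro m
  induction m with
  | zero =>
    intro _
    exact ⟨Fin.elim0, Fin.elim0, ⟨fun i => i.elim0, fun i => i.elim0⟩,
      ⟨fun i => i.elim0, fun i => i.elim0⟩, fun i => i.elim0⟩
  | succ m ih =>
    intro hm
    obtain ⟨g, e, hg, he, hge⟩ := ih (by omega)
    let U := Submodule.span ℂ (Set.range e)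
    let V := Submodule.span ℂ (Set.range g)
    have hU : FiniteDimensional ℂ U := FiniteDimensional.span_of_finite ℂ (Set.finite_range e)
    have hV : FiniteDimensional ℂ V := FiniteDimensional.span_of_finite ℂ (Set.finite_range g)
    have hrank (v : Fin m → H) [FiniteDimensional ℂ (Submodule.span ℂ (Set.range v))] :
        LinearMap.rank ((Submodule.span ℂ (Set.range v)).starProjection : H →ₗ[ℂ] H) ≤ m := by
      rw [LinearMap.rank, Submodule.range_starProjection]
      refine (rank_span_le _).trans ?_
      have := Cardinal.mk_range_le_lift (f := v)
      simpa using this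
    let R : H →L[ℂ] H := T ∘L U.starProjection + V.starProjection ∘L (T ∘L (1 - U.starProjection))
    have hR : LinearMap.rank (R : H →ₗ[ℂ] H) ≤ (2 * k : ℕ) := by
      have h1 : LinearMap.rank (R : H →ₗ[ℂ] H) ≤ (m : Cardinal) + m :=
        (LinearMap.rank_add_le _ _).trans (add_le_add
          ((LinearMap.rank_comp_le_right _ _).trans (hrank e))
          ((LinearMap.rank_comp_le_left _ _).trans (hrank g)))
      refine h1.trans ?_
      rw [← Nat.cast_add]
      exact_mod_cast (by omega : m + m ≤ 2 * k)
    have hlt : t < ‖T - R‖ := htT.trans_le (sNum_le_norm_sub T hR)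
    obtain ⟨x, hx⟩ : ∃ x, t * ‖x‖ < ‖(T - R) x‖ := by
      by_contra! h
      exact hlt.not_ge (ContinuousLinearMap.opNorm_le_bound _ ht h)
    set u := x - U.starProjection x with hu
    set y := T u - V.starProjection (T u) with hy
    have hxy : (T - R) x = y := by
      simp [R, hy, hu]
      abel
    have hux : ‖u‖ ≤ ‖x‖ := by
      simpa [Submodule.starProjection_orthogonal'] using Uᗮ.norm_starProjection_apply_le x
    have huU : u ∈ Uᗮ := Submodule.sub_starProjection_mem_orthogonal x
    have hyV : y ∈ Vᗮ := Submodule.sub_starProjection_mem_orthogonal _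
    have hy0 : y ≠ 0 := by
      rintro h
      rw [hxy, h, norm_zero] at hx
      exact hx.not_ge (by positivity)
    have hu0 : u ≠ 0 := by
      rintro h
      exact hy0 (by simp [hy, h])
    have hiy : inner ℂ y (T u) = ((‖y‖ ^ 2 : ℝ) : ℂ) := by
      have : T u = y + V.starProjection (T u) := by rw [hy]; abel
      rw [this, inner_add_right, Submodule.inner_left_of_mem_orthogonal
        (V.starProjection_apply_mem _) hyV, inner_self_eq_norm_sq_to_K, add_zero]
      simp
    have hortho {v : Fin m → H} {w : H} (hw : w ∈ (Submodule.span ℂ (Set.range v))ᗮ) (c : ℂ)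
        (i : Fin m) : inner ℂ (c • w) (v i) = 0 := by
      rw [inner_smul_left, Submodule.inner_left_of_mem_orthogonal
        (Submodule.subset_span (Set.mem_range_self i)) hw, mul_zero]
    refine ⟨Matrix.vecCons ((‖y‖ : ℂ)⁻¹ • y) g, Matrix.vecCons ((‖u‖ : ℂ)⁻¹ • u) e,
      orthonormal_vecCons_iff.2 ⟨by simp [norm_smul, hy0], hortho hyV _, hg⟩,
      orthonormal_vecCons_iff.2 ⟨by simp [norm_smul, hu0], hortho huU _, he⟩, ?_⟩
    intro i
    refine Fin.cases ?_ (fun i => by simpa using hge i) i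
    refine ⟨‖y‖ / ‖u‖, ?_, ?_⟩
    · rw [le_div_iff₀ (norm_pos_iff.2 hu0), ← hxy]
      exact (mul_le_mul_of_nonneg_left hux ht).trans hx.le
    · simp only [Matrix.cons_val_zero, map_smul, inner_smul_left, inner_smul_right, hiy]
      have := norm_ne_zero_iff.2 hy0
      have := norm_ne_zero_iff.2 hu0
      push_cast
      simp
      field_simp

variable [CompleteSpace H]

theorem norm_sum_inner_le_of_contractions (T : H →L[ℂ] H) (k : ℕ) :
    ∀ A B : EuclideanSpace ℂ (Fin k) →L[ℂ] H, ‖A‖ ≤ 1 → ‖B‖ ≤ 1 →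
      ‖∑ i, inner ℂ (A (EuclideanSpace.basisFun (Fin k) ℂ i))
        (T (B (EuclideanSpace.basisFun (Fin k) ℂ i)))‖ ≤ ∑ i ∈ Finset.range k, sNum T i := by
  induction k with
  | zero => intro A B _ _; simp
  | succ k ih =>
    intro A B hA hB
    refine le_of_forall_pos_le_add fun ε hε => ?_
    obtain ⟨R, hR, hlt⟩ := exists_rank_le_norm_sub_lt T (lt_add_of_pos_right (sNum T k) hε)
    obtain ⟨x, hx0, hx⟩ := exists_ne_zero_apply_eq_zero hR (by simp) B.toLinearMap
    let u : EuclideanSpace ℂ (Fin (k + 1)) := ((‖x‖ : ℂ)⁻¹) • x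
    have hu : ‖u‖ = 1 := by simp [u, norm_smul, hx0]
    have hRu : R (B u) = 0 := by
      have : R (B x) = 0 := hx
      simp [u, this]
    have hon : Orthonormal ℂ (({0} : Set (Fin (k + 1))).domRestrict fun _ => u) := by
      refine ⟨fun i => hu, fun i j hij => (hij (Subsingleton.elim i j)).elim⟩
    obtain ⟨b, hb⟩ := hon.exists_orthonormalBasis_extension_of_card_eq (by simp)
    have hb0 : b 0 = u := hb 0 rfl
    obtain ⟨J, hJ, hJb⟩ := (b.orthonormal.comp Fin.succ (Fin.succ_injective k)).exists_euclidean_map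
    have e : ∑ i, inner ℂ (A (EuclideanSpace.basisFun (Fin (k + 1)) ℂ i))
        (T (B (EuclideanSpace.basisFun (Fin (k + 1)) ℂ i))) =
        ∑ i, inner ℂ (A (b i)) (T (B (b i))) := by
      have h1 := LinearMap.trace_eq_sum_inner (A.adjoint ∘L T ∘L B).toLinearMap
        (EuclideanSpace.basisFun (Fin (k + 1)) ℂ)
      have h2 := LinearMap.trace_eq_sum_inner (A.adjoint ∘L T ∘L B).toLinearMap b
      simpa [ContinuousLinearMap.adjoint_inner_right] using h1.symm.trans h2
    have h1 : ‖inner ℂ (A u) (T (B u))‖ ≤ sNum T k + ε := by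
      have hAu : ‖A u‖ ≤ 1 := (A.le_of_opNorm_le hA u).trans (by rw [hu, one_mul])
      have hBu : ‖B u‖ ≤ 1 := (B.le_of_opNorm_le hB u).trans (by rw [hu, one_mul])
      have h2 : T (B u) = (T - R) (B u) := by simp [hRu]
      rw [h2]
      calc _ ≤ ‖A u‖ * (‖T - R‖ * ‖B u‖) := (norm_inner_le_norm _ _).trans
            (mul_le_mul_of_nonneg_left ((T - R).le_opNorm _) (norm_nonneg _))
        _ ≤ 1 * (‖T - R‖ * 1) := by gcongr
        _ ≤ _ := by linarith
    have h2 := ih (A ∘L J) (B ∘L J)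
      ((A.opNorm_comp_le J).trans (mul_le_one₀ hA (norm_nonneg _) hJ))
      ((B.opNorm_comp_le J).trans (mul_le_one₀ hB (norm_nonneg _) hJ))
    simp only [ContinuousLinearMap.comp_apply, hJb, Function.comp] at h2
    rw [e, Fin.sum_univ_succ, hb0, Finset.sum_range_succ]
    refine (norm_add_le _ _).trans ?_
    linarith

theorem norm_sum_inner_le (T : H →L[ℂ] H) (k : ℕ) (A B : EuclideanSpace ℂ (Fin k) →L[ℂ] H) :
    ‖∑ i, inner ℂ (A (EuclideanSpace.basisFun (Fin k) ℂ i))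
      (T (B (EuclideanSpace.basisFun (Fin k) ℂ i)))‖ ≤
      ‖A‖ * ‖B‖ * ∑ i ∈ Finset.range k, sNum T i := by
  rcases eq_or_ne A 0 with rfl | hA
  · simp
  rcases eq_or_ne B 0 with rfl | hB
  · simp
  have hA' := norm_pos_iff.2 hA
  have hB' := norm_pos_iff.2 hB
  have h := norm_sum_inner_le_of_contractions T k ((‖A‖⁻¹ : ℂ) • A) ((‖B‖⁻¹ : ℂ) • B)
    (by simp [norm_smul, hA]) (by simp [norm_smul, hB])
  simp only [smul_apply, map_smul, inner_smul_left, inner_smul_right,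
    ← Finset.mul_sum, norm_mul, map_inv₀, norm_inv, RCLike.norm_conj, Complex.norm_real,
    norm_norm] at h
  rw [inv_mul_le_iff₀ hB', inv_mul_le_iff₀ hA'] at h
  linarith

theorem Orthonormal.norm_sum_inner_le {k : ℕ} {g e : Fin k → H} (hg : Orthonormal ℂ g)
    (he : Orthonormal ℂ e) (T X Y : H →L[ℂ] H) :
    ‖∑ i, inner ℂ (g i) ((X * T * Y) (e i))‖ ≤
      (∑ i ∈ Finset.range k, sNum T i) * (‖X‖ * ‖Y‖) := by
  obtain ⟨G, hG, hGg⟩ := hg.exists_euclidean_map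
  obtain ⟨E, hE, hEe⟩ := he.exists_euclidean_map
  have h := _root_.norm_sum_inner_le T k (X.adjoint ∘L G) (Y ∘L E)
  simp only [ContinuousLinearMap.comp_apply, hGg, hEe, ContinuousLinearMap.adjoint_inner_left] at h
  have h1 : ‖X.adjoint ∘L G‖ ≤ ‖X‖ := (ContinuousLinearMap.opNorm_comp_le _ _).trans
    (by rw [LinearIsometryEquiv.norm_map]; exact mul_le_of_le_one_right (norm_nonneg _) hG)
  have h2 : ‖Y ∘L E‖ ≤ ‖Y‖ := (ContinuousLinearMap.opNorm_comp_le _ _).trans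
    (mul_le_of_le_one_right (norm_nonneg _) hE)
  have h3 : 0 ≤ ∑ i ∈ Finset.range k, sNum T i := Finset.sum_nonneg fun i _ => sNum_nonneg T i
  refine h.trans ?_
  rw [mul_comm]
  gcongr

theorem Orthonormal.norm_sum_inner_star_le {k : ℕ} {g e : Fin k → H} (hg : Orthonormal ℂ g)
    (he : Orthonormal ℂ e) (T X Y : H →L[ℂ] H) :
    ‖∑ i, inner ℂ (g i) ((X * star T * Y) (e i))‖ ≤
      (∑ i ∈ Finset.range k, sNum T i) * (‖X‖ * ‖Y‖) := by
  have h := he.norm_sum_inner_le hg T (star Y) (star X)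
  rw [norm_star, norm_star, mul_comm ‖Y‖] at h
  refine le_of_eq_of_le ?_ h
  rw [← RCLike.norm_conj, map_sum]
  congr 1
  refine Finset.sum_congr rfl fun i _ => ?_
  rw [inner_conj_symm, ← ContinuousLinearMap.adjoint_inner_right,
    ← ContinuousLinearMap.star_eq_adjoint]
  simp [mul_assoc]

end SingularValues

section HolderSingularValues

theorem rank_le_of_disjoint_ker {H : Type*} [AddCommGroup H] [Module ℂ H] {G R : H →ₗ[ℂ] H}
    (h : ∀ y, R (G y) = 0 → G y = 0) :
    LinearMap.rank G ≤ LinearMap.rank R := by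
  refine LinearMap.rank_le_of_injective (R.rangeRestrict ∘ₗ (LinearMap.range G).subtype)
    (LinearMap.ker_eq_bot.1 (LinearMap.ker_eq_bot'.2 ?_))
  rintro ⟨_, y, rfl⟩ hy
  exact Subtype.ext (h y (congrArg Subtype.val hy))

variable {H : Type*} [NormedAddCommGroup H] [InnerProductSpace ℂ H] [CompleteSpace H]

theorem exists_sNum_cfc_sub_le {α : ℝ} (hα : 0 < α) (hα1 : α < 1) : ∃ C : ℝ, 0 ≤ C ∧
    ∀ (H : Type*) [NormedAddCommGroup H] [InnerProductSpace ℂ H] [CompleteSpace H]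
      (a b : H →L[ℂ] H), IsStarNormal a → IsStarNormal b → ∀ (f : ℂ → ℂ) (M : ℝ), 0 ≤ M →
      (∀ z w, ‖f z - f w‖ ≤ M * ‖z - w‖ ^ α) → ∀ k : ℕ,
      sNum (cfc f a - cfc f b) (2 * k) ≤
        C * M * ((∑ i ∈ Finset.range (k + 1), sNum (a - b) i) / (k + 1 : ℕ)) ^ α := by
  obtain ⟨C, hC, h⟩ := exists_norm_apply_cfc_sub_le hα hα1
  refine ⟨2 * C, by positivity, ?_⟩
  intro H _ _ _ a b _ _ f M hM hf k
  set σ : ℝ := (∑ i ∈ Finset.range (k + 1), sNum (a - b) i) / (k + 1 : ℕ) with hσ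
  have hs0 : 0 ≤ ∑ i ∈ Finset.range (k + 1), sNum (a - b) i :=
    Finset.sum_nonneg fun i _ => sNum_nonneg _ i
  have hk : (0 : ℝ) < (k + 1 : ℕ) := by positivity
  have hσ0 : 0 ≤ σ := by positivity
  have hb0 : 0 ≤ 2 * C * M * σ ^ α := by positivity
  by_contra! hlt
  obtain ⟨t, ht1, ht2⟩ := exists_between hlt
  refine ht1.not_ge ?_
  obtain ⟨g, e, hg, he, hge⟩ :=
    exists_orthonormal_lt_inner _ (hb0.trans ht1.le) ht2 (k + 1) le_rfl
  have hlim : Filter.Tendsto (fun δ : ℝ => 2 * C * M * δ ^ α) (nhdsWithin σ (Set.Ioi σ))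
      (nhds (2 * C * M * σ ^ α)) :=
    ((Real.continuousAt_rpow_const σ α (Or.inr hα.le)).tendsto.mono_left
      nhdsWithin_le_nhds).const_mul _
  refine ge_of_tendsto hlim (Filter.eventually_of_mem self_mem_nhdsWithin fun δ hδ => ?_)
  have hδ0 : 0 < δ := hσ0.trans_lt hδ
  have hsum : ∑ i ∈ Finset.range (k + 1), sNum (a - b) i ≤ (k + 1 : ℕ) * δ := by
    have := (div_lt_iff₀ hk).1 hδ
    linarith
  let Λ : (H →L[ℂ] H) →L[ℂ] ℂ :=
    ∑ i, (innerSL ℂ (g i)).comp (ContinuousLinearMap.apply ℂ H (e i))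
  have hΛ (X : H →L[ℂ] H) : Λ X = ∑ i, inner ℂ (g i) (X (e i)) := by
    simp [Λ]
  have hΛn : ‖Λ‖ ≤ (k + 1 : ℕ) := by
    refine Λ.opNorm_le_bound hk.le fun X => ?_
    rw [hΛ]
    refine (norm_sum_le _ _).trans ((Finset.sum_le_card_nsmul _ _ ‖X‖ fun i _ => ?_).trans_eq
      (by simp))
    refine (norm_inner_le_norm _ _).trans ?_
    rw [hg.1 i, one_mul]
    exact (X.le_opNorm _).trans_eq (by rw [he.1 i, mul_one])
  have h1 := h (a := a) (b := b) Λ (κ := (k + 1 : ℕ) * δ) (by positivity)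
    (fun X Y => by
      rw [hΛ]
      exact (hg.norm_sum_inner_le he _ X Y).trans (by gcongr))
    (fun X Y => by
      rw [hΛ]
      exact (hg.norm_sum_inner_star_le he _ X Y).trans (by gcongr)) hM hf hδ0
  choose r hr hgr using hge
  have h2 : (k + 1 : ℕ) * t ≤ ‖Λ (cfc f a - cfc f b)‖ := by
    rw [hΛ, Finset.sum_congr rfl fun i _ => hgr i, ← Complex.ofReal_sum, Complex.norm_real]
    refine le_trans ?_ (le_abs_self _)
    simpa using Finset.card_nsmul_le_sum Finset.univ r t fun i _ => hr i
  have h3 : ‖Λ‖ * δ ^ α + (k + 1 : ℕ) * δ * δ ^ (α - 1) ≤ (k + 1 : ℕ) * (2 * δ ^ α) := by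
    have : δ * δ ^ (α - 1) = δ ^ α := by rw [Real.rpow_sub_one hδ0.ne']; field_simp
    rw [mul_assoc, this]
    have := mul_le_mul_of_nonneg_right hΛn (by positivity : 0 ≤ δ ^ α)
    linarith
  refine le_of_mul_le_mul_left ?_ hk
  calc _ ≤ _ := h2
    _ ≤ _ := h1
    _ ≤ C * M * ((k + 1 : ℕ) * (2 * δ ^ α)) := by gcongr
    _ = _ := by ring

theorem opAbsRpow_eq_cfc (T : H →L[ℂ] H) {r : ℝ} (hr : 0 ≤ r) :
    opAbsRpow T r = cfc (fun t : ℝ => Real.sqrt t ^ r) (star T * T) := by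
  have hc : Continuous fun t : ℝ => t ^ r := Real.continuous_rpow_const hr
  rw [opAbsRpow, opAbs, ← cfc_comp' (fun t : ℝ => t ^ r) Real.sqrt (star T * T)
    hc.continuousOn Real.continuous_sqrt.continuousOn]

theorem sNum_opAbsRpow_le (T : H →L[ℂ] H) {r : ℝ} (hr : 0 ≤ r) (j : ℕ) :
    sNum (opAbsRpow T r) j ≤ sNum T j ^ r := by
  have hlim : Filter.Tendsto (fun c : ℝ => c ^ r) (nhdsWithin (sNum T j) (Set.Ioi (sNum T j)))
      (nhds (sNum T j ^ r)) :=
    (Real.continuousAt_rpow_const _ r (Or.inr hr)).tendsto.mono_left nhdsWithin_le_nhds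
  refine ge_of_tendsto hlim (Filter.eventually_of_mem self_mem_nhdsWithin fun c hc => ?_)
  obtain ⟨R, hR, hRc⟩ := exists_rank_le_norm_sub_lt T (Set.mem_Ioi.1 hc)
  have hc0 : 0 < c := (norm_nonneg _).trans_lt hRc
  have hpow : Continuous fun t : ℝ => Real.sqrt t ^ r :=
    (Real.continuous_rpow_const hr).comp Real.continuous_sqrt
  set g : ℝ → ℝ := fun t => max (Real.sqrt t ^ r - c ^ r) 0 with hg
  have hgc : Continuous g := by fun_prop
  set S : H →L[ℂ] H := star T * T with hS
  have hSsa : IsSelfAdjoint S := IsSelfAdjoint.star_mul_self T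
  set G : H →L[ℂ] H := cfc g S with hG
  have hGsa : IsSelfAdjoint G := cfc_predicate g S
  have hker (y : H) (hy : R (G y) = 0) : G y = 0 := by
    have hpos : 0 ≤ G * (S - algebraMap ℝ (H →L[ℂ] H) (c ^ 2)) * G := by
      have : G * (S - algebraMap ℝ (H →L[ℂ] H) (c ^ 2)) * G =
          cfc (fun t => g t * (t - c ^ 2) * g t) S := by
        rw [cfc_mul _ _ S, cfc_mul _ _ S, cfc_sub _ _ S, cfc_id' ℝ S, cfc_const _ S]
      rw [this]
      refine cfc_nonneg fun t ht => ?_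
      rcases le_total (c ^ 2) t with h | h
      · have : 0 ≤ g t := le_max_right _ _
        have := sub_nonneg.2 h
        positivity
      · have : g t = 0 := by
          refine max_eq_right (sub_nonpos.2 ?_)
          exact Real.rpow_le_rpow (Real.sqrt_nonneg t) (Real.sqrt_le_iff.2 ⟨hc0.le, h⟩) hr
        simp [this]
    have h1 := ((ContinuousLinearMap.nonneg_iff_isPositive _).1 hpos).re_inner_nonneg_right y
    have h2 : inner ℂ y ((G * (S - algebraMap ℝ (H →L[ℂ] H) (c ^ 2)) * G) y) =
        ((‖T (G y)‖ ^ 2 - c ^ 2 * ‖G y‖ ^ 2 : ℝ) : ℂ) := by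
      have h3 (z : H) : inner ℂ y (G z) = inner ℂ (G y) z := by
        rw [← ContinuousLinearMap.adjoint_inner_left, hGsa.adjoint_eq]
      have h4 : algebraMap ℝ (H →L[ℂ] H) (c ^ 2) (G y) = (c ^ 2 : ℂ) • G y := by
        rw [Algebra.algebraMap_eq_smul_one]
        simp [← Complex.ofReal_pow]
      rw [mul_apply_eq_comp, mul_apply_eq_comp, h3, sub_apply, h4, hS,
        mul_apply_eq_comp, ContinuousLinearMap.star_eq_adjoint, inner_sub_right,
        ContinuousLinearMap.adjoint_inner_right, inner_smul_right, inner_self_eq_norm_sq_to_K,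
        inner_self_eq_norm_sq_to_K]
      push_cast
      rfl
    rw [h2] at h1
    have h3 : T (G y) = (T - R) (G y) := by simp [hy]
    have h4 : ‖T (G y)‖ ≤ ‖T - R‖ * ‖G y‖ := by rw [h3]; exact (T - R).le_opNorm _
    by_contra hne
    have h5 : 0 < ‖G y‖ := norm_pos_iff.2 hne
    have h6 : ‖T (G y)‖ < c * ‖G y‖ := h4.trans_lt (by gcongr)
    have h7 : ‖T (G y)‖ ^ 2 < (c * ‖G y‖) ^ 2 := by gcongr
    rw [RCLike.re_eq_complex_re, Complex.ofReal_re] at h1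
    linarith [mul_pow c ‖G y‖ 2]
  rw [opAbsRpow_eq_cfc T hr]
  refine (sNum_le_norm_sub _ ((rank_le_of_disjoint_ker hker).trans hR)).trans ?_
  rw [hG, ← cfc_sub _ _ S hpow.continuousOn hgc.continuousOn]
  have hcr : 0 ≤ c ^ r := by positivity
  refine norm_cfc_le hcr fun t _ => ?_
  have h0 : 0 ≤ Real.sqrt t ^ r := by positivity
  rw [Real.norm_eq_abs, abs_le, hg]
  constructor
  · rcases max_cases (Real.sqrt t ^ r - c ^ r) 0 with h | h <;> simp only [h.1] <;> linarith
  · linarith [le_max_left (Real.sqrt t ^ r - c ^ r) 0]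

end HolderSingularValues

theorem mul_rpow_sub_one_le {p u v : ℝ} (hp : 1 < p) (hu : 0 ≤ u) (hv : 0 ≤ v) :
    p * (u * v ^ (p - 1)) ≤ u ^ p + (p - 1) * v ^ p := by
  have h := Real.young_inequality_of_nonneg hu (Real.rpow_nonneg hv (p - 1))
    (Real.HolderConjugate.conjExponent hp)
  have hp1 : p - 1 ≠ 0 := by linarith
  have hp0 : p ≠ 0 := by linarith
  rw [← Real.rpow_mul hv, Real.conjExponent, mul_div_cancel₀ _ hp1] at h
  have h2 := mul_le_mul_of_nonneg_left h (by linarith : 0 ≤ p)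
  refine h2.trans_eq ?_
  field_simp

/-- The partial-sum form of Hardy's inequality. -/
theorem sum_average_rpow_le {p : ℝ} (hp : 1 < p) {a : ℕ → ℝ} (ha : ∀ n, 0 ≤ a n) (N : ℕ) :
    ∑ n ∈ Finset.range N, ((∑ i ∈ Finset.range (n + 1), a i) / (n + 1 : ℕ)) ^ p ≤
      (p / (p - 1)) ^ p * ∑ n ∈ Finset.range N, a n ^ p := by
  set X : ℕ → ℝ := fun n => (∑ i ∈ Finset.range n, a i) / n with hX
  have hp1 : 0 < p - 1 := by linarith
  have hp0 : 0 < p := by linarith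
  have hX0 (n : ℕ) : 0 ≤ X n := div_nonneg (Finset.sum_nonneg fun i _ => ha i) n.cast_nonneg
  have hrec (n : ℕ) : a n = (n + 1) * X (n + 1) - n * X n := by
    have h1 : ((n + 1 : ℕ) : ℝ) * X (n + 1) = ∑ i ∈ Finset.range (n + 1), a i :=
      mul_div_cancel₀ _ (by positivity)
    have h2 : (n : ℝ) * X n = ∑ i ∈ Finset.range n, a i := by
      rcases Nat.eq_zero_or_pos n with rfl | hn
      · simp
      · exact mul_div_cancel₀ _ (by positivity)
    push_cast at h1
    rw [h1, h2, Finset.sum_range_succ]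
    ring
  have hmul (n : ℕ) : X n ^ p = X n * X n ^ (p - 1) := by
    rcases (hX0 n).eq_or_lt with h | h
    · rw [← h, Real.zero_rpow hp0.ne', zero_mul]
    · rw [Real.rpow_sub_one h.ne']
      field_simp
  have hElliott (N : ℕ) : (p - 1) * ∑ n ∈ Finset.range N, X (n + 1) ^ p + N * X N ^ p ≤
      ∑ n ∈ Finset.range N, p * (a n * X (n + 1) ^ (p - 1)) := by
    induction N with
    | zero => simp
    | succ n ih =>
      rw [Finset.sum_range_succ, Finset.sum_range_succ]
      have h1 := mul_le_mul_of_nonneg_left (mul_rpow_sub_one_le hp (hX0 n) (hX0 (n + 1)))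
        (n.cast_nonneg : (0 : ℝ) ≤ n)
      have h2 : p * (a n * X (n + 1) ^ (p - 1)) = p * ((n + 1) * X (n + 1) ^ p) -
          n * (p * (X n * X (n + 1) ^ (p - 1))) := by
        rw [hrec n, hmul (n + 1)]
        ring
      rw [h2]
      push_cast
      linarith
  have hp' : 0 < p / (p - 1) := by positivity
  have hY : ∑ n ∈ Finset.range N, p * (a n * X (n + 1) ^ (p - 1)) ≤
      (p - 1) / p * ((p / (p - 1)) ^ p * ∑ n ∈ Finset.range N, a n ^ p +
        (p - 1) * ∑ n ∈ Finset.range N, X (n + 1) ^ p) := by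
    rw [Finset.mul_sum, Finset.mul_sum, ← Finset.sum_add_distrib, Finset.mul_sum]
    refine Finset.sum_le_sum fun n _ => ?_
    have h := mul_rpow_sub_one_le hp (mul_nonneg hp'.le (ha n)) (hX0 (n + 1))
    rw [Real.mul_rpow hp'.le (ha n)] at h
    refine le_trans (le_of_eq ?_) (mul_le_mul_of_nonneg_left h (by positivity))
    field_simp
  have h1 := hElliott N
  have h2 : 0 ≤ N * X N ^ p := mul_nonneg N.cast_nonneg (Real.rpow_nonneg (hX0 N) p)
  have h3 := h1.trans hY
  change ∑ n ∈ Finset.range N, X (n + 1) ^ p ≤ _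
  set Y := ∑ n ∈ Finset.range N, X (n + 1) ^ p
  set Z := (p / (p - 1)) ^ p * ∑ n ∈ Finset.range N, a n ^ p
  rw [div_mul_eq_mul_div, le_div_iff₀ hp0] at h3
  have h4 : 0 ≤ N * X N ^ p * p := mul_nonneg h2 hp0.le
  have h5 : (p - 1) * Y ≤ (p - 1) * Z := by nlinarith
  exact le_of_mul_le_mul_left h5 hp1

theorem average_half_le {a : ℕ → ℝ} (ha : ∀ n, 0 ≤ a n) (j : ℕ) :
    (∑ i ∈ Finset.range (j / 2 + 1), a i) / (j / 2 + 1 : ℕ) ≤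
      2 * ((∑ i ∈ Finset.range (j + 1), a i) / (j + 1 : ℕ)) := by
  have h1 : ∑ i ∈ Finset.range (j / 2 + 1), a i ≤ ∑ i ∈ Finset.range (j + 1), a i :=
    Finset.sum_le_sum_of_subset_of_nonneg (Finset.range_subset_range.2 (by omega))
      fun i _ _ => ha i
  have h2 : ((j + 1 : ℕ) : ℝ) ≤ 2 * (j / 2 + 1 : ℕ) := by
    exact_mod_cast (by omega : j + 1 ≤ 2 * (j / 2 + 1))
  have h3 : 0 ≤ ∑ i ∈ Finset.range (j + 1), a i := Finset.sum_nonneg fun i _ => ha i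
  rw [div_le_iff₀ (by positivity), mul_div_assoc', div_mul_eq_mul_div, le_div_iff₀ (by positivity)]
  calc _ ≤ (∑ i ∈ Finset.range (j + 1), a i) * (2 * (j / 2 + 1 : ℕ)) := by gcongr
    _ = _ := by ring

/-- Let `0 < α < 1` and `1 < p < ∞`. There is `c > 0` (depending only on `α, p`) such that
for every `f ∈ Λ_α(ℝ²)` with Hölder bound `M` (so `‖f‖_{Λ_α} ≤ M`), every `l ∈ ℤ₊`, and all
bounded normal operators `N₁, N₂`,
`Σ_{j=0}^l s_j(|f(N₁) - f(N₂)|^{1/α})^p ≤ c M^{p/α} Σ_{j=0}^l s_j(N₁ - N₂)^p`. -/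
theorem holder_schatten_partial_sums :
    ∀ (α p : ℝ), 0 < α → α < 1 → 1 < p →
    ∃ c : ℝ, 0 < c ∧
      ∀ (f : ℂ → ℂ) (M : ℝ), 0 ≤ M →
      (∀ z₁ z₂ : ℂ, ‖f z₁ - f z₂‖ ≤ M * ‖z₁ - z₂‖ ^ α) →
      ∀ (l : ℕ),
      ∀ (H : Type*) [NormedAddCommGroup H] [InnerProductSpace ℂ H] [CompleteSpace H]
        (N₁ N₂ : H →L[ℂ] H), IsStarNormal N₁ → IsStarNormal N₂ →
        ∑ j ∈ Finset.range (l + 1), sNum (opAbsRpow (cfc f N₁ - cfc f N₂) (1 / α)) j ^ p ≤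
          c * M ^ (p / α) * ∑ j ∈ Finset.range (l + 1), sNum (N₁ - N₂) j ^ p := by
  intro α p hα hα1 hp
  obtain ⟨C, hC, h⟩ := exists_sNum_cfc_sub_le hα hα1
  have hp0 : 0 < p := by linarith
  have hp' : 0 < p / (p - 1) := div_pos hp0 (by linarith)
  refine ⟨C ^ (p / α) * 2 ^ p * (p / (p - 1)) ^ p + 1, by positivity, ?_⟩
  intro f M hM hf l H _ _ _ N₁ N₂ h₁ h₂
  set s := sNum (N₁ - N₂)
  set T := cfc f N₁ - cfc f N₂
  have hs : ∀ n, 0 ≤ s n := sNum_nonneg _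
  have hσ (j : ℕ) : 0 ≤ (∑ i ∈ Finset.range (j + 1), s i) / (j + 1 : ℕ) :=
    div_nonneg (Finset.sum_nonneg fun i _ => hs i) (Nat.cast_nonneg _)
  have key (j : ℕ) : sNum (opAbsRpow T (1 / α)) j ^ p ≤ C ^ (p / α) * 2 ^ p * M ^ (p / α) *
      ((∑ i ∈ Finset.range (j + 1), s i) / (j + 1 : ℕ)) ^ p := by
    set σ := (∑ i ∈ Finset.range (j + 1), s i) / (j + 1 : ℕ) with hσj
    have hσ0 : 0 ≤ σ := hσ j
    have hT : sNum T j ≤ C * M * (2 * σ) ^ α := by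
      refine (sNum_antitone T (by omega : 2 * (j / 2) ≤ j)).trans
        ((h H N₁ N₂ h₁ h₂ f M hM hf (j / 2)).trans ?_)
      have := hσ (j / 2)
      gcongr
      exact average_half_le hs j
    calc _ ≤ (sNum T j ^ (1 / α)) ^ p := Real.rpow_le_rpow (sNum_nonneg _ _)
          (sNum_opAbsRpow_le T (by positivity) j) hp0.le
      _ = sNum T j ^ (p / α) := by
          rw [← Real.rpow_mul (sNum_nonneg _ _), one_div_mul_eq_div]
      _ ≤ (C * M * (2 * σ) ^ α) ^ (p / α) :=
          Real.rpow_le_rpow (sNum_nonneg _ _) hT (by positivity)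
      _ = _ := by
          rw [Real.mul_rpow (by positivity) (by positivity), Real.mul_rpow hC hM,
            ← Real.rpow_mul (by positivity), mul_div_cancel₀ _ hα.ne',
            Real.mul_rpow zero_le_two hσ0]
          ring
  refine (Finset.sum_le_sum fun j _ => key j).trans ?_
  rw [← Finset.mul_sum]
  have hsum : 0 ≤ ∑ j ∈ Finset.range (l + 1), s j ^ p :=
    Finset.sum_nonneg fun j _ => Real.rpow_nonneg (hs j) p
  calc _ ≤ C ^ (p / α) * 2 ^ p * M ^ (p / α) *
        ((p / (p - 1)) ^ p * ∑ j ∈ Finset.range (l + 1), s j ^ p) := by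
        gcongr
        exact sum_average_rpow_le hp hs (l + 1)
    _ = (C ^ (p / α) * 2 ^ p * (p / (p - 1)) ^ p) * M ^ (p / α) *
        ∑ j ∈ Finset.range (l + 1), s j ^ p := by ring
    _ ≤ _ := by
        gcongr
        linarith
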